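/- arXiv:2407.12546 — 2 statements merged into one kernel-verified Lean document; each statement's English description precedes it below -/
import Mathlib

section
/- Let n ≥ 17, p ≥ 1, let n₁,…,n_{p+1} be positive integers with n₁+⋯+n_{p+1} = n, let a₁,…,a_{p+1} be pairwise distinct real numbers, and let D = diag(a₁I_{n₁},…,a_{p+1}I_{n_{p+1}}) and M = {QDQᵀ : Q ∈ SO_n(ℝ)}. If (V,ρ) is any finite-dimensional continuous real representation of SO_n(ℝ) and ε : M → V is an injective continuous SO_n(ℝ)-equivariant map (ε(QXQᵀ) = ρ(Q)ε(X) for all Q ∈ SO_n(ℝ) and X ∈ M), then dim V ≥ (n−1)(n+2)/2. -/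
open Matrix Topology

/-- `SOn n` is the set of real `n × n` special orthogonal matrices. -/
def SOn (n : ℕ) : Set (Matrix (Fin n) (Fin n) ℝ) :=
  {Q | Qᵀ * Q = 1 ∧ Q.det = 1}

theorem mul_swap_eq_swap_mul {ι : Type*} [DecidableEq ι] (σ : Equiv.Perm ι) (i j : ι) :
    σ * Equiv.swap i j = Equiv.swap (σ i) (σ j) * σ := by
  rw [Equiv.swap_apply_apply]; simp

section SymmetricGroup

variable {ι U : Type*} [DecidableEq ι] [AddCommGroup U] [Module ℝ U]
  (T : Representation ℝ (Equiv.Perm ι) U)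

theorem apply_apply_swap (σ : Equiv.Perm ι) (i j : ι) (x : U) :
    T σ (T (Equiv.swap i j) x) = T (Equiv.swap (σ i) (σ j)) (T σ x) := by
  rw [← Module.End.mul_apply, ← map_mul, mul_swap_eq_swap_mul, map_mul, Module.End.mul_apply]

theorem apply_swap_apply_swap (i j : ι) (x : U) :
    T (Equiv.swap i j) (T (Equiv.swap i j) x) = x := by
  rw [← Module.End.mul_apply, ← map_mul]; simp

theorem apply_swap_self (i : ι) (x : U) : T (Equiv.swap i i) x = x := by
  rw [Equiv.swap_self, ← Equiv.Perm.one_def, map_one, Module.End.one_apply]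

/-- If `T (swap i j) - 1` has rank at most one, its range is spanned by any `-1`-eigenvector. -/
theorem exists_apply_swap_eq_add_smul {i j : ι}
    (hrank : ∃ w : U, ∀ x, ∃ c : ℝ, T (Equiv.swap i j) x = x + c • w)
    {h : U} (h0 : h ≠ 0) (hh : T (Equiv.swap i j) h = -h) (x : U) :
    ∃ c : ℝ, T (Equiv.swap i j) x = x + c • h := by
  obtain ⟨w, hw⟩ := hrank
  obtain ⟨c, hc⟩ := hw x
  obtain ⟨e, he⟩ := hw h
  have he' : e • w = (-2 : ℝ) • h := by
    rw [hh] at he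
    linear_combination (norm := module) (-1 : ℝ) • he
  have he0 : e ≠ 0 := by
    rintro rfl
    rw [zero_smul] at he'
    exact h0 ((smul_eq_zero.1 he'.symm).resolve_left (by norm_num))
  refine ⟨c * (e⁻¹ * (-2)), ?_⟩
  rw [hc, mul_smul, mul_smul, ← he', inv_smul_smul₀ he0]

/-- A vector negated by one transposition and fixed by all disjoint ones generates a copy of the
reflection representation, of dimension `card ι - 1`. -/
theorem card_le_finrank_add_one_of_reflections [Fintype ι] [FiniteDimensional ℝ U]
    (hι : 4 ≤ Fintype.card ι)
    (hrank : ∀ i j, i ≠ j → ∃ w : U, ∀ x, ∃ c : ℝ, T (Equiv.swap i j) x = x + c • w)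
    {a b : ι} (hab : a ≠ b) {h : U} (h0 : h ≠ 0) (hneg : T (Equiv.swap a b) h = -h)
    (hfix : ∀ c d, c ≠ d → c ≠ a → c ≠ b → d ≠ a → d ≠ b → T (Equiv.swap c d) h = h) :
    Fintype.card ι ≤ Module.finrank ℝ U + 1 := by
  have hconj := apply_apply_swap T
  have hinv := apply_swap_apply_swap T
  set H : ι → U := fun j => T (Equiv.swap b j) h with hH
  have hHb : H b = h := apply_swap_self T b h
  have hH0 (j : ι) : H j ≠ 0 := fun hj => h0 (by
    rw [← hinv b j h]
    change T (Equiv.swap b j) (H j) = 0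
    rw [hj, map_zero])
  have hHmove (j k : ι) (hja : j ≠ a) (hka : k ≠ a) : T (Equiv.swap j k) (H j) = H k := by
    rcases eq_or_ne j k with rfl | hjk
    · exact apply_swap_self T j _
    rcases eq_or_ne j b with rfl | hjb
    · rw [hHb]
    rcases eq_or_ne k b with rfl | hkb
    · rw [hHb, Equiv.swap_comm]; exact hinv _ _ _
    · simp only [hH]
      rw [hconj, Equiv.swap_apply_of_ne_of_ne hjb.symm hkb.symm, Equiv.swap_apply_left,
        hfix j k hjk hja hjb hka hkb]
  have hHstay (j k l : ι) (hjk : j ≠ k) (hlj : l ≠ j) (hlk : l ≠ k) (hja : j ≠ a) (hka : k ≠ a)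
      (hla : l ≠ a) : T (Equiv.swap j k) (H l) = H l := by
    rw [← hHmove b l hab.symm hla, hHb, ← Equiv.swap_comm l b]
    have : T (Equiv.swap j k) (T (Equiv.swap l b) h) = T (Equiv.swap l b)
        (T (Equiv.swap (Equiv.swap l b j) (Equiv.swap l b k)) h) := by
      rw [hconj (Equiv.swap l b)]; simp
    have hfixa (m : ι) (hma : m ≠ a) : Equiv.swap l b m ≠ a := fun he => hma
      ((Equiv.swap l b).injective (he.trans (Equiv.swap_apply_of_ne_of_ne hla.symm hab).symm))
    have hfixb (m : ι) (hlm : l ≠ m) : Equiv.swap l b m ≠ b := fun he => hlm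
      ((Equiv.swap l b).injective (he.trans (Equiv.swap_apply_left l b).symm)).symm
    rw [this, hfix]
    · simpa using hjk
    · exact hfixa j hja
    · exact hfixb j hlj
    · exact hfixa k hka
    · exact hfixb k hlk
  have hHneg (j : ι) (hja : j ≠ a) : T (Equiv.swap a j) (H j) = -H j := by
    rcases eq_or_ne j b with rfl | hjb
    · rw [hHb, hneg]
    · have := hconj (Equiv.swap b j) a b h
      rw [Equiv.swap_apply_of_ne_of_ne hab hja.symm, Equiv.swap_apply_left, hneg, map_neg] at this
      exact this.symm
  have hconjaj (j k : ι) (hja : j ≠ a) (hka : k ≠ a) (hjk : j ≠ k) (x : U) :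
      T (Equiv.swap j k) (T (Equiv.swap a j) x)
        = T (Equiv.swap a j) (T (Equiv.swap a k) x) := by
    rw [hconj (Equiv.swap a j) a k, Equiv.swap_apply_left,
      Equiv.swap_apply_of_ne_of_ne hka hjk.symm]
  have hHinj (j k : ι) (hja : j ≠ a) (hka : k ≠ a) (hjk : j ≠ k) : H j ≠ H k := by
    intro he
    have h1 := hconjaj j k hja hka hjk (H j)
    rw [hHneg j hja, map_neg, hHmove j k hja hka, he, hHneg k hka, map_neg, ← he, hHneg j hja,
      neg_neg] at h1
    have h2 : (2 : ℝ) • H j = 0 := by linear_combination (norm := module) -h1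
    exact hH0 j ((smul_eq_zero.1 h2).resolve_left (by norm_num))
  have hHrefl (j k : ι) (hja : j ≠ a) (hka : k ≠ a) (hjk : j ≠ k) :
      T (Equiv.swap a j) (H k) = H k - H j := by
    obtain ⟨α, hα⟩ := exists_apply_swap_eq_add_smul T (hrank a j hja.symm) (hH0 j) (hHneg j hja) (H k)
    have h1 := hconjaj j k hja hka hjk (H k)
    rw [hHneg k hka, map_neg, hα, map_add, map_smul, hHmove j k hja hka, Equiv.swap_comm j k,
      hHmove k j hka hja] at h1
    have h2 : (1 + α) • (H j + H k) = 0 := by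
      linear_combination (norm := module) h1
    rcases smul_eq_zero.1 h2 with h3 | h3
    · rw [hα, show α = -1 by linarith, neg_smul, one_smul, sub_eq_add_neg]
    · exfalso
      obtain ⟨l, hl⟩ : ∃ l, l ∉ ({a, j, k} : Finset ι) := by
        by_contra! hall
        have := Finset.card_le_card (fun x _ => hall x : Finset.univ ⊆ ({a, j, k} : Finset ι))
        have h3 := Finset.card_le_three (a := a) (b := j) (c := k)
        rw [Finset.card_univ] at this
        omega
      simp only [Finset.mem_insert, Finset.mem_singleton, not_or] at hl
      obtain ⟨hla, hlj, hlk⟩ := hl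
      have h4 := congrArg (T (Equiv.swap k l)) h3
      rw [map_add, map_zero, hHmove k l hka hla,
        hHstay k l j (Ne.symm hlk) hjk (Ne.symm hlj) hka hla hja] at h4
      exact hHinj k l hka hla (Ne.symm hlk) (add_left_cancel (h3.trans h4.symm))
  have hli : LinearIndependent ℝ (fun j : {j : ι // j ≠ a} => H j) := by
    rw [Fintype.linearIndependent_iff]
    intro c hc
    have hall (k : {j : ι // j ≠ a}) : c k = -∑ j, c j := by
      have h1 := congrArg (T (Equiv.swap a k)) hc
      have h2 (j : {j : ι // j ≠ a}) : T (Equiv.swap a k) (c j • H j)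
          = c j • H j - (c j + if j = k then c j else 0) • H k := by
        rw [map_smul]
        split_ifs with hjk
        · subst hjk
          rw [hHneg _ j.2]
          module
        · rw [hHrefl k j k.2 j.2 (fun h => hjk (Subtype.ext h.symm))]
          module
      rw [map_sum, map_zero, Finset.sum_congr rfl fun j _ => h2 j, Finset.sum_sub_distrib, hc,
        ← Finset.sum_smul, zero_sub, neg_eq_zero, Finset.sum_add_distrib,
        Finset.sum_ite_eq' Finset.univ k c, if_pos (Finset.mem_univ _)] at h1
      linarith [(smul_eq_zero.1 h1).resolve_right (hH0 k)]
    have hS : ∑ j, c j = 0 := by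
      have h1 : ∑ j, c j = ∑ _j : {j : ι // j ≠ a}, -∑ j, c j :=
        Finset.sum_congr rfl fun k _ => hall k
      rw [Finset.sum_const, nsmul_eq_mul] at h1
      have h2 : (1 + ((Finset.univ : Finset {j : ι // j ≠ a}).card : ℝ)) * ∑ j, c j = 0 := by
        linear_combination h1
      exact (mul_eq_zero.1 h2).resolve_left
        (add_pos_of_pos_of_nonneg one_pos (Nat.cast_nonneg _)).ne'
    intro k
    rw [hall k, hS, neg_zero]
  have hcard := hli.fintype_card_le_finrank
  rw [Fintype.card_subtype_compl, Fintype.card_subtype_eq] at hcard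
  omega

/-- If every transposition of a symmetric group acts as the identity or as a reflection on a
real representation of dimension less than `card ι - 1`, then each vector is fixed by some
permutation sending a prescribed point to a prescribed different point. -/
theorem exists_perm_fixing_of_finrank_lt [Fintype ι] [FiniteDimensional ℝ U] (hι : 4 ≤ Fintype.card ι)
    (hdim : Module.finrank ℝ U + 1 < Fintype.card ι)
    (hrank : ∀ i j, i ≠ j → ∃ w : U, ∀ x, ∃ c : ℝ, T (Equiv.swap i j) x = x + c • w)
    (v : U) (a b : ι) (hab : a ≠ b) : ∃ σ : Equiv.Perm ι, σ a = b ∧ T σ v = v := by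
  by_contra! hcon
  have hconj := apply_apply_swap T
  have hinv := apply_swap_apply_swap T
  set h : U := T (Equiv.swap a b) v - v with hdef
  have hv : T (Equiv.swap a b) v = v + h := by rw [hdef]; abel
  have h0 : h ≠ 0 := fun h0 => hcon (Equiv.swap a b) (by simp) (by rw [hv, h0, add_zero])
  have hneg : T (Equiv.swap a b) h = -h := by
    rw [hdef, map_sub, hinv]; abel
  have hfix (c d : ι) (hcd : c ≠ d) (hca : c ≠ a) (hcb : c ≠ b) (hda : d ≠ a) (hdb : d ≠ b) :
      T (Equiv.swap c d) h = h := by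
    have hcomm (x : U) : T (Equiv.swap c d) (T (Equiv.swap a b) x)
        = T (Equiv.swap a b) (T (Equiv.swap c d) x) := by
      rw [hconj, Equiv.swap_apply_of_ne_of_ne hca.symm hda.symm,
        Equiv.swap_apply_of_ne_of_ne hcb.symm hdb.symm]
    obtain ⟨k, hk⟩ := exists_apply_swap_eq_add_smul T (hrank a b hab) h0 hneg (T (Equiv.swap c d) v)
    have hk' : T (Equiv.swap c d) h = k • h := by
      rw [hdef, map_sub, hcomm, hk, ← hdef]; abel
    have hkk : (k * k - 1) • h = 0 := by
      have := hinv c d h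
      rw [hk', map_smul, hk', smul_smul] at this
      rw [sub_smul, this, one_smul, sub_self]
    have hk1 : (k - 1) * (k + 1) = 0 := by
      linear_combination (smul_eq_zero.1 hkk).resolve_right h0
    rcases mul_eq_zero.1 hk1 with hk1 | hk1
    · rw [hk', sub_eq_zero.1 hk1, one_smul]
    · exfalso
      have hkn : T (Equiv.swap c d) h = -h := by
        rw [hk', eq_neg_of_add_eq_zero_left hk1, neg_smul, one_smul]
      obtain ⟨e, he⟩ := exists_apply_swap_eq_add_smul T (hrank c d hcd) h0 hkn v
      have h1 := hcomm v
      rw [hv, he, map_add, map_add, map_smul, hneg, hkn, he, hv] at h1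
      have h2 : (2 * (e - 1)) • h = 0 := by
        linear_combination (norm := module) h1
      have h3 : e = 1 := by
        have := (smul_eq_zero.1 h2).resolve_right h0
        linarith
      refine hcon (Equiv.swap a b * Equiv.swap c d) ?_ ?_
      · rw [Equiv.Perm.mul_apply, Equiv.swap_apply_of_ne_of_ne hca.symm hda.symm,
          Equiv.swap_apply_left]
      · rw [map_mul, Module.End.mul_apply, he, h3, one_smul, ← hv, hinv]
  have := card_le_finrank_add_one_of_reflections T hι hrank hab h0 hneg hfix
  omega

end SymmetricGroup
/-- The set `SOn n` as a submonoid of the matrices. -/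
def specialOrthogonal (n : ℕ) : Submonoid (Matrix (Fin n) (Fin n) ℝ) where
  carrier := SOn n
  one_mem' := ⟨by simp, by simp⟩
  mul_mem' := by
    rintro A B ⟨hA, hA'⟩ ⟨hB, hB'⟩
    refine ⟨?_, by rw [det_mul, hA', hB', one_mul]⟩
    rw [transpose_mul, Matrix.mul_assoc, ← Matrix.mul_assoc Aᵀ, hA, Matrix.one_mul, hB]

theorem units_cast_mul_self (u : ℤˣ) : ((u : ℤ) : ℝ) * ((u : ℤ) : ℝ) = 1 := by
  rcases Int.units_eq_one_or u with rfl | rfl <;> simp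

theorem prod_units_cast {n : ℕ} (t : Fin n → ℤˣ) :
    ∏ i, ((t i : ℤ) : ℝ) = ((∏ i, t i : ℤˣ) : ℤ) := by
  rw [Units.coe_prod, Int.cast_prod]

/-- Sign vectors with an even number of minus signs. -/
abbrev EvenSigns (n : ℕ) : Type := {s : Fin n → ℤˣ // ∏ i, s i = 1}

/-- The diagonal matrix of an even sign vector. -/
def signDiag {n : ℕ} (s : EvenSigns n) : specialOrthogonal n :=
  ⟨diagonal fun i => ((s.1 i : ℤ) : ℝ), by
    refine ⟨?_, ?_⟩
    · simp [units_cast_mul_self]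
    · rw [det_diagonal, prod_units_cast, s.2, Units.val_one, Int.cast_one]⟩

theorem coe_signDiag {n : ℕ} (s : EvenSigns n) :
    (signDiag s : Matrix (Fin n) (Fin n) ℝ) = diagonal fun i => ((s.1 i : ℤ) : ℝ) := rfl

theorem signDiag_mul_comm {n : ℕ} (s t : EvenSigns n) :
    signDiag s * signDiag t = signDiag t * signDiag s := by
  ext1
  simp [coe_signDiag, mul_comm]

/-- There is an even sign vector with minus signs exactly at `k` and `l`. -/
theorem exists_evenSigns {n : ℕ} {k l : Fin n} (hkl : k ≠ l) :
    ∃ s : EvenSigns n, ∀ i, s.1 i = if i = k ∨ i = l then -1 else 1 := by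
  refine ⟨⟨fun i => if i = k ∨ i = l then -1 else 1, ?_⟩, fun i => rfl⟩
  rw [Finset.prod_ite, Finset.prod_const_one, mul_one, Finset.prod_const,
    show (Finset.univ.filter fun i => i = k ∨ i = l) = {k, l} by ext; simp,
    Finset.card_pair hkl]
  simp

section Weights

variable {n : ℕ} {V : Type*} [AddCommGroup V] [Module ℝ V]
  (ρ : Representation ℝ (specialOrthogonal n) V)

/-- The value of the character indexed by `S` on an even sign vector. -/
def signChar (S : Finset (Fin n)) (s : EvenSigns n) : ℝ := ∏ k ∈ S, ((s.1 k : ℤ) : ℝ)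

/-- The joint eigenspace of the even diagonal sign matrices for the character indexed by `S`. -/
def signWeightSpace (S : Finset (Fin n)) : Submodule ℝ V :=
  ⨅ s : EvenSigns n, Module.End.eigenspace (ρ (signDiag s)) (signChar S s)

theorem mem_signWeightSpace {S : Finset (Fin n)} {x : V} :
    x ∈ signWeightSpace ρ S ↔ ∀ s : EvenSigns n, ρ (signDiag s) x = signChar S s • x := by
  simp [signWeightSpace, Submodule.mem_iInf]

theorem signChar_injOn (hn : 5 ≤ n) {S T : Finset (Fin n)} (hS : S.card ≤ 2) (hT : T.card ≤ 2)
    (h : signChar S = signChar T) : S = T := by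
  by_contra hST
  wlog hk : ∃ k ∈ S, k ∉ T generalizing S T
  · refine this hT hS h.symm (Ne.symm hST) ?_
    by_contra! hTS
    push Not at hk
    exact hST (Finset.Subset.antisymm hk hTS)
  obtain ⟨k, hkS, hkT⟩ := hk
  obtain ⟨l, hl⟩ : ∃ l, l ∉ S ∪ T := by
    by_contra! hall
    have h1 := Finset.card_le_card (fun x _ => hall x : Finset.univ ⊆ S ∪ T)
    have h2 := Finset.card_union_le S T
    rw [Finset.card_univ, Fintype.card_fin] at h1
    omega
  rw [Finset.mem_union, not_or] at hl
  obtain ⟨s, hs⟩ := exists_evenSigns (show k ≠ l by rintro rfl; exact hl.1 hkS)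
  have h1 : signChar S s = -1 := by
    rw [signChar, Finset.prod_eq_single k]
    · simp [hs]
    · intro i hi hik
      have hil : i ≠ l := by rintro rfl; exact hl.1 hi
      simp [hs, hik, hil]
    · exact fun h => absurd hkS h
  have h2 : signChar T s = 1 := by
    refine Finset.prod_eq_one fun i hi => ?_
    have hik : i ≠ k := by rintro rfl; exact hkT hi
    have hil : i ≠ l := by rintro rfl; exact hl.2 hi
    simp [hs, hik, hil]
  rw [h, h2] at h1
  norm_num at h1

theorem sum_finrank_le_of_iSupIndep {κ W : Type*} [Fintype κ] [AddCommGroup W] [Module ℝ W]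
    [FiniteDimensional ℝ W] {A : κ → Submodule ℝ W} (hA : iSupIndep A) :
    ∑ i, Module.finrank ℝ (A i) ≤ Module.finrank ℝ W := by
  classical
  rw [← Module.finrank_directSum (R := ℝ) fun i => A i]
  exact LinearMap.finrank_le_finrank_of_injective (f := DFinsupp.lsum ℝ fun i => (A i).subtype)
    hA.dfinsupp_lsum_injective

theorem sum_finrank_signWeightSpace_le [FiniteDimensional ℝ V] (hn : 5 ≤ n)
    (F : Finset (Finset (Fin n))) (hF : ∀ S ∈ F, S.card ≤ 2) :
    ∑ S ∈ F, Module.finrank ℝ (signWeightSpace ρ S) ≤ Module.finrank ℝ V := by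
  have hind : iSupIndep fun χ : EvenSigns n → ℝ =>
      ⨅ s, Module.End.maxGenEigenspace (ρ (signDiag s)) (χ s) := by
    refine Module.End.independent_iInf_maxGenEigenspace_of_forall_mapsTo _ fun s t φ => ?_
    refine Module.End.mapsTo_maxGenEigenspace_of_comm ?_ φ
    change _ * _ = _ * _
    rw [← map_mul, ← map_mul, signDiag_mul_comm]
  have hind' : iSupIndep fun S : F => signWeightSpace ρ S.1 := by
    refine (hind.comp (f := fun S : F => signChar S.1) ?_).mono ?_
    · intro S T hST
      exact Subtype.ext (signChar_injOn hn (hF _ S.2) (hF _ T.2) hST)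
    · intro S
      exact iInf_mono fun s => (Module.End.genEigenspace _ _).mono le_top
  rw [← Finset.sum_coe_sort F fun S => Module.finrank ℝ (signWeightSpace ρ S)]
  exact sum_finrank_le_of_iSupIndep hind'

end Weights

/-- `g` is a signed permutation matrix with underlying permutation `σ`. -/
def IsSignedPerm {n : ℕ} (g : specialOrthogonal n) (σ : Equiv.Perm (Fin n)) : Prop :=
  ∃ t : Fin n → ℤˣ, ∀ i j, g.1 i j = if i = σ j then ((t j : ℤ) : ℝ) else 0

section SignedPerm

variable {n : ℕ}

theorem IsSignedPerm.mul {g g' : specialOrthogonal n} {σ τ : Equiv.Perm (Fin n)}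
    (hg : IsSignedPerm g σ) (hg' : IsSignedPerm g' τ) : IsSignedPerm (g * g') (σ * τ) := by
  obtain ⟨t, ht⟩ := hg
  obtain ⟨t', ht'⟩ := hg'
  refine ⟨fun j => t (τ j) * t' j, fun i j => ?_⟩
  rw [Submonoid.coe_mul, Matrix.mul_apply, Finset.sum_eq_single (τ j)]
  · simp [ht, ht']
  · intro k _ hk
    simp [ht', hk]
  · simp

theorem isSignedPerm_one : IsSignedPerm (1 : specialOrthogonal n) 1 :=
  ⟨1, fun i j => by simp [Matrix.one_apply]⟩

theorem IsSignedPerm.signDiag_mul {g : specialOrthogonal n} {σ : Equiv.Perm (Fin n)}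
    (hg : IsSignedPerm g σ) (s s' : EvenSigns n) (hs : ∀ j, s'.1 j = s.1 (σ j)) :
    signDiag s * g = g * signDiag s' := by
  obtain ⟨t, ht⟩ := hg
  ext i j
  rw [Submonoid.coe_mul, Submonoid.coe_mul, coe_signDiag, coe_signDiag, diagonal_mul,
    mul_diagonal, ht, hs]
  split_ifs with h
  · rw [h, mul_comm]
  · simp

theorem IsSignedPerm.exists_eq_mul_signDiag {g g' : specialOrthogonal n}
    {σ : Equiv.Perm (Fin n)} (hg : IsSignedPerm g σ) (hg' : IsSignedPerm g' σ) :
    ∃ s : EvenSigns n, g' = g * signDiag s := by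
  obtain ⟨t, ht⟩ := hg
  obtain ⟨t', ht'⟩ := hg'
  have hmul : g'.1 = g.1 * diagonal fun i => (((t i * t' i : ℤˣ) : ℤ) : ℝ) := by
    ext i j
    rw [mul_diagonal, ht, ht']
    split_ifs
    · push_cast
      rw [← mul_assoc, units_cast_mul_self, one_mul]
    · simp
  have hprod : ∏ i, t i * t' i = 1 := by
    have := congrArg det hmul
    rw [det_mul, g.2.2, g'.2.2, det_diagonal, one_mul, prod_units_cast] at this
    exact Units.ext (Int.cast_injective (α := ℝ) (by rw [← this, Units.val_one, Int.cast_one]))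
  exact ⟨⟨fun i => t i * t' i, hprod⟩, Subtype.ext hmul⟩

theorem exists_isSignedPerm (hn : 0 < n) (σ : Equiv.Perm (Fin n)) :
    ∃ g : specialOrthogonal n, IsSignedPerm g σ := by
  let t : Fin n → ℤˣ := Function.update 1 ⟨0, hn⟩ (Equiv.Perm.sign σ)
  let A : Matrix (Fin n) (Fin n) ℝ := Matrix.of fun i j => if i = σ j then ((t j : ℤ) : ℝ) else 0
  have hA : A = (σ⁻¹).permMatrix ℝ * diagonal fun i => ((t i : ℤ) : ℝ) := by
    ext i j
    rw [mul_diagonal]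
    simp [A, PEquiv.toMatrix_apply, Equiv.symm_apply_eq]
  refine ⟨⟨A, ?_, ?_⟩, t, fun i j => rfl⟩
  · rw [hA, transpose_mul, transpose_permMatrix, diagonal_transpose, Matrix.mul_assoc,
      ← Matrix.mul_assoc (Equiv.Perm.permMatrix ℝ _), ← permMatrix_mul]
    simp [units_cast_mul_self]
  · rw [hA, det_mul, det_permutation, det_diagonal, Equiv.Perm.sign_inv]
    have : ∏ i, t i = Equiv.Perm.sign σ := by
      simp [t, Finset.prod_update_of_mem]
    rw [prod_units_cast, this, units_cast_mul_self]

end SignedPerm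

section Rotation

variable {n : ℕ}

/-- The rotation with cosine `c` and sine `s` in the coordinate plane of `i` and `j`. -/
def planeRotation (i j : Fin n) (c s : ℝ) : Matrix (Fin n) (Fin n) ℝ :=
  1 + (c - 1) • (single i i 1 + single j j 1) + s • (single j i 1 - single i j 1)

theorem planeRotation_mul {i j : Fin n} (hij : i ≠ j) (c s c' s' : ℝ) :
    planeRotation i j c s * planeRotation i j c' s'
      = planeRotation i j (c * c' - s * s') (c * s' + s * c') := by
  simp only [planeRotation, mul_add, add_mul, smul_mul_assoc, mul_smul_comm, mul_sub, sub_mul,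
    one_mul, mul_one, single_mul_single_same, single_mul_single_of_ne _ _ _ _ hij,
    single_mul_single_of_ne _ _ _ _ hij.symm]
  module

theorem planeRotation_one_zero (i j : Fin n) : planeRotation i j 1 0 = 1 := by
  simp [planeRotation]

theorem transpose_planeRotation (i j : Fin n) (c s : ℝ) :
    (planeRotation i j c s)ᵀ = planeRotation i j c (-s) := by
  simp only [planeRotation, transpose_add, transpose_sub, transpose_smul, transpose_one,
    transpose_single]
  module

theorem planeRotation_mem {i j : Fin n} (hij : i ≠ j) (θ : ℝ) :
    planeRotation i j (Real.cos θ) (Real.sin θ) ∈ specialOrthogonal n := by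
  have horth (φ : ℝ) : (planeRotation i j (Real.cos φ) (Real.sin φ))ᵀ
      * planeRotation i j (Real.cos φ) (Real.sin φ) = 1 := by
    rw [transpose_planeRotation, planeRotation_mul hij, ← planeRotation_one_zero i j]
    congr 1
    · linear_combination Real.cos_sq_add_sin_sq φ
    · ring
  refine ⟨horth θ, ?_⟩
  have hhalf : planeRotation i j (Real.cos θ) (Real.sin θ)
      = planeRotation i j (Real.cos (θ / 2)) (Real.sin (θ / 2))
        * planeRotation i j (Real.cos (θ / 2)) (Real.sin (θ / 2)) := by
    rw [planeRotation_mul hij]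
    have h := add_halves θ
    congr 1
    · rw [← Real.cos_add, h]
    · rw [add_comm, ← Real.sin_add, h]
  have h1 := congrArg det (horth (θ / 2))
  rw [det_mul, det_transpose, det_one] at h1
  rw [hhalf, det_mul, h1]

theorem diagonal_mul_planeRotation {i j : Fin n} (hij : i ≠ j) (c s : ℝ) (e : Fin n → ℝ)
    (he : ∀ k, e k * e k = 1) :
    diagonal e * planeRotation i j c s = planeRotation i j c (e i * e j * s) * diagonal e := by
  ext k l
  rw [diagonal_mul, mul_diagonal]
  have hi := he i
  have hj := he j
  rcases eq_or_ne k l with rfl | hkl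
  · rcases eq_or_ne k i with rfl | hki
    · simp [planeRotation, hij.symm, mul_comm]
    · rcases eq_or_ne k j with rfl | hkj
      · simp [planeRotation, hij, mul_comm]
      · simp [planeRotation, hki.symm, hkj.symm]
  · simp only [planeRotation, Matrix.add_apply, Matrix.sub_apply, Matrix.smul_apply,
      Matrix.one_apply, single_apply, smul_eq_mul]
    have h1 : ¬ (i = k ∧ i = l) := fun h => hkl (h.1.symm.trans h.2)
    have h2 : ¬ (j = k ∧ j = l) := fun h => hkl (h.1.symm.trans h.2)
    rw [if_neg hkl, if_neg h1, if_neg h2]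
    split_ifs with h3 h4 h4
    · exact absurd (h3.1.trans h4.1.symm) hij.symm
    · rw [← h3.1, ← h3.2]
      linear_combination (-s * e j) * hi
    · rw [← h4.1, ← h4.2]
      linear_combination (s * e i) * hj
    · simp

theorem isSignedPerm_planeRotation {i j : Fin n} (hij : i ≠ j) (g : specialOrthogonal n)
    (hg : g.1 = planeRotation i j 0 1) : IsSignedPerm g (Equiv.swap i j) := by
  refine ⟨fun k => if k = j then -1 else 1, fun k l => ?_⟩
  rw [hg]
  rcases eq_or_ne l i with rfl | hli
  · rw [Equiv.swap_apply_left]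
    simp [planeRotation, single_apply, hij, hij.symm, Matrix.one_apply]
    grind
  · rcases eq_or_ne l j with rfl | hlj
    · rw [Equiv.swap_apply_right]
      simp [planeRotation, single_apply, hij, Matrix.one_apply]
      grind
    · rw [Equiv.swap_apply_of_ne_of_ne hli hlj]
      simp [planeRotation, hli.symm, hlj.symm, Matrix.one_apply, hlj]

end Rotation

section SmallRepresentations

variable {n : ℕ} {V : Type*} [AddCommGroup V] [Module ℝ V]
  (ρ : Representation ℝ (specialOrthogonal n) V)

theorem apply_eq_of_mem_signWeightSpace_empty {x : V} (hx : x ∈ signWeightSpace ρ ∅)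
    (s : EvenSigns n) : ρ (signDiag s) x = x := by
  simpa [signChar] using (mem_signWeightSpace ρ).1 hx s

theorem IsSignedPerm.apply_eq_apply {g g' : specialOrthogonal n} {σ : Equiv.Perm (Fin n)}
    (hg : IsSignedPerm g σ) (hg' : IsSignedPerm g' σ) {x : V} (hx : x ∈ signWeightSpace ρ ∅) :
    ρ g' x = ρ g x := by
  obtain ⟨s, rfl⟩ := hg.exists_eq_mul_signDiag hg'
  rw [map_mul, Module.End.mul_apply, apply_eq_of_mem_signWeightSpace_empty ρ hx]

theorem IsSignedPerm.apply_mem {g : specialOrthogonal n} {σ : Equiv.Perm (Fin n)}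
    (hg : IsSignedPerm g σ) {S : Finset (Fin n)} {x : V} (hx : x ∈ signWeightSpace ρ S) :
    ρ g x ∈ signWeightSpace ρ (S.map σ.toEmbedding) := by
  rw [mem_signWeightSpace] at hx ⊢
  intro s
  let s' : EvenSigns n := ⟨fun j => s.1 (σ j), by rw [Equiv.prod_comp σ s.1, s.2]⟩
  rw [← Module.End.mul_apply, ← map_mul, hg.signDiag_mul s s' fun _ => rfl, map_mul,
    Module.End.mul_apply, hx s', map_smul]
  simp [signChar, s', Finset.prod_map]

theorem apply_injective (g : specialOrthogonal n) : Function.Injective (ρ g) := by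
  let g' : specialOrthogonal n :=
    ⟨g.1ᵀ, by rw [transpose_transpose]; exact mul_eq_one_comm.1 g.2.1,
      by rw [det_transpose]; exact g.2.2⟩
  have hinv : g' * g = 1 := Subtype.ext g.2.1
  refine Function.LeftInverse.injective (g := ρ g') fun x => ?_
  rw [← Module.End.mul_apply, ← map_mul, hinv, map_one, Module.End.one_apply]

theorem finrank_signWeightSpace_le_map [FiniteDimensional ℝ V] (hn : 0 < n)
    (σ : Equiv.Perm (Fin n)) (S : Finset (Fin n)) :
    Module.finrank ℝ (signWeightSpace ρ S)
      ≤ Module.finrank ℝ (signWeightSpace ρ (S.map σ.toEmbedding)) := by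
  obtain ⟨g, hg⟩ := exists_isSignedPerm hn σ
  refine LinearMap.finrank_le_finrank_of_injective
    (f := (ρ g).restrict fun x hx => hg.apply_mem ρ hx) fun x y hxy => ?_
  exact Subtype.ext (apply_injective ρ g (congrArg Subtype.val hxy))

theorem finrank_signWeightSpace_le_of_card_eq [FiniteDimensional ℝ V] (hn : 0 < n)
    {S T : Finset (Fin n)} (hST : S.card = T.card) :
    Module.finrank ℝ (signWeightSpace ρ S) ≤ Module.finrank ℝ (signWeightSpace ρ T) := by
  obtain ⟨σ, hσ⟩ : ∃ σ : Equiv.Perm (Fin n), S.map σ.toEmbedding = T := by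
    let e : S ≃ T := Finset.equivOfCardEq hST
    refine ⟨e.extendSubtype, Finset.eq_of_subset_of_card_le ?_ (by simp [hST])⟩
    intro x hx
    obtain ⟨y, hy, rfl⟩ := Finset.mem_map.1 hx
    exact e.extendSubtype_mem y hy
  exact hσ ▸ finrank_signWeightSpace_le_map ρ hn σ S

/-- The symmetric group acts on the vectors fixed by the even diagonal sign matrices. -/
theorem exists_perm_representation (hn : 0 < n) :
    ∃ T : Representation ℝ (Equiv.Perm (Fin n)) (signWeightSpace ρ ∅),
      ∀ σ g, IsSignedPerm g σ → ∀ x, (T σ x : V) = ρ g x := by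
  choose L hL using exists_isSignedPerm hn
  let T (σ : Equiv.Perm (Fin n)) : Module.End ℝ (signWeightSpace ρ ∅) :=
    (ρ (L σ)).restrict fun x hx => by simpa using (hL σ).apply_mem ρ hx
  have hT (σ : Equiv.Perm (Fin n)) (x : signWeightSpace ρ ∅) : (T σ x : V) = ρ (L σ) x := rfl
  refine ⟨{ toFun := T, map_one' := ?_, map_mul' := ?_ }, fun σ g hg x =>
    (hg.apply_eq_apply ρ (hL σ) x.2)⟩
  · ext x
    rw [hT, isSignedPerm_one.apply_eq_apply ρ (hL 1) x.2, map_one]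
    rfl
  · intro σ τ
    ext x
    rw [Module.End.mul_apply, hT, hT, hT,
      ((hL σ).mul (hL τ)).apply_eq_apply ρ (hL (σ * τ)) x.2, map_mul, Module.End.mul_apply]

/-- A linear map into the weight space of `{i, j}` whose kernel consists of vectors fixed by
the transposition of `i` and `j`. -/
theorem exists_linearMap_signWeightSpace_pair {i j : Fin n} (hij : i ≠ j) :
    ∃ f : signWeightSpace ρ ∅ →ₗ[ℝ] signWeightSpace ρ {i, j},
      ∀ x, f x = 0 → ∀ g, IsSignedPerm g (Equiv.swap i j) → ρ g x = x := by
  let R (θ : ℝ) : specialOrthogonal n := ⟨_, planeRotation_mem hij θ⟩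
  have hmul (θ φ : ℝ) : R θ * R φ = R (θ + φ) := by
    refine Subtype.ext ((planeRotation_mul hij _ _ _ _).trans ?_)
    rw [← Real.cos_add, add_comm (Real.cos θ * _), ← Real.sin_add]
  have hzero : R 0 = 1 := Subtype.ext (by simp [R, planeRotation_one_zero])
  have hconj (s : EvenSigns n) (θ : ℝ) (x : V) (hx : x ∈ signWeightSpace ρ ∅)
      (u : ℤˣ) (hu : s.1 i * s.1 j = u) :
      ρ (signDiag s) (ρ (R θ) x) = ρ (R (((u : ℤ) : ℝ) * θ)) x := by
    have h : signDiag s * R θ = R (((u : ℤ) : ℝ) * θ) * signDiag s := by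
      refine Subtype.ext ((diagonal_mul_planeRotation hij _ _ _ fun k =>
        units_cast_mul_self (s.1 k)).trans ?_)
      rw [← Int.cast_mul, ← Units.val_mul, hu, Submonoid.coe_mul, coe_signDiag]
      rcases Int.units_eq_one_or u with rfl | rfl <;> simp [R]
    rw [← Module.End.mul_apply, ← map_mul, h, map_mul, Module.End.mul_apply,
      apply_eq_of_mem_signWeightSpace_empty ρ hx]
  have hmem (x : V) (hx : x ∈ signWeightSpace ρ ∅) :
      (ρ (R (Real.pi / 4)) - ρ (R (-(Real.pi / 4)))) x ∈ signWeightSpace ρ {i, j} := by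
    rw [mem_signWeightSpace]
    intro s
    have hchar : signChar {i, j} s = ((s.1 i * s.1 j : ℤˣ) : ℤ) := by
      simp [signChar, Finset.prod_pair hij]
    rw [hchar, LinearMap.sub_apply, map_sub, hconj s _ x hx _ rfl, hconj s _ x hx _ rfl]
    rcases Int.units_eq_one_or (s.1 i * s.1 j) with h | h <;> simp [h]
  refine ⟨(ρ (R (Real.pi / 4)) - ρ (R (-(Real.pi / 4)))).restrict hmem, fun x hx g hg => ?_⟩
  have hx' : ρ (R (Real.pi / 4)) x = ρ (R (-(Real.pi / 4))) x :=
    sub_eq_zero.1 (congrArg Subtype.val hx)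
  have hperm : IsSignedPerm (R (Real.pi / 2)) (Equiv.swap i j) :=
    isSignedPerm_planeRotation hij _ (by simp [R])
  rw [hperm.apply_eq_apply ρ hg x.2, show Real.pi / 2 = Real.pi / 4 + Real.pi / 4 by ring, ← hmul,
    map_mul, Module.End.mul_apply, hx', ← Module.End.mul_apply, ← map_mul, hmul, add_neg_cancel,
    hzero, map_one, Module.End.one_apply]

theorem exists_eq_add_smul_of_ker_le {U W : Type*} [AddCommGroup U] [Module ℝ U]
    [AddCommGroup W] [Module ℝ W] [FiniteDimensional ℝ W] (hW : Module.finrank ℝ W ≤ 1)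
    (f : U →ₗ[ℝ] W) (A : U →ₗ[ℝ] U) (hA : ∀ x, f x = 0 → A x = x) :
    ∃ w : U, ∀ x, ∃ c : ℝ, A x = x + c • w := by
  by_cases hf : ∃ x₀, f x₀ ≠ 0
  · obtain ⟨x₀, hx₀⟩ := hf
    refine ⟨A x₀ - x₀, fun x => ?_⟩
    obtain ⟨e, he⟩ := finrank_le_one_iff.1 hW
    obtain ⟨c₀, hc₀⟩ := he (f x₀)
    obtain ⟨c, hc⟩ := he (f x)
    have h0 : c₀ ≠ 0 := by
      rintro rfl
      exact hx₀ (by rw [← hc₀, zero_smul])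
    have h1 := hA (x - (c / c₀) • x₀) (by
      rw [map_sub, map_smul, ← hc₀, ← hc, smul_smul, div_mul_cancel₀ c h0, sub_self])
    refine ⟨c / c₀, ?_⟩
    rw [map_sub, map_smul] at h1
    linear_combination (norm := module) h1
  · push Not at hf
    exact ⟨0, fun x => ⟨0, by rw [hA x (hf x), smul_zero, add_zero]⟩⟩

/-- In a representation of dimension less than `(n - 1) * (n + 2) / 2`, a vector fixed by the even
diagonal sign matrices is fixed by signed permutations moving any index to any other. -/
theorem exists_isSignedPerm_apply_eq [FiniteDimensional ℝ V] (hn : 5 ≤ n)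
    (hdim : 2 * Module.finrank ℝ V < (n - 1) * (n + 2)) {v : V} (hv : v ∈ signWeightSpace ρ ∅)
    {a b : Fin n} (hab : a ≠ b) :
    ∃ σ g, σ a = b ∧ IsSignedPerm g σ ∧ ρ g v = v := by
  set m := Module.finrank ℝ (signWeightSpace ρ {a, b}) with hm
  have hcard (S : Finset (Fin n)) (hS : S.card = 2) :
      Module.finrank ℝ (signWeightSpace ρ S) = m :=
    le_antisymm
      (finrank_signWeightSpace_le_of_card_eq ρ (by omega) (by rw [hS, Finset.card_pair hab]))
      (finrank_signWeightSpace_le_of_card_eq ρ (by omega) (by rw [hS, Finset.card_pair hab]))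
  have hsum : Module.finrank ℝ (signWeightSpace ρ ∅) + n.choose 2 * m ≤ Module.finrank ℝ V := by
    have h := sum_finrank_signWeightSpace_le ρ hn
      (insert ∅ (Finset.powersetCard 2 Finset.univ)) (by
        intro S hS
        rcases Finset.mem_insert.1 hS with rfl | hS
        · simp
        · exact (Finset.mem_powersetCard.1 hS).2.le)
    rwa [Finset.sum_insert (by simp [Finset.mem_powersetCard]),
      Finset.sum_congr rfl fun S hS => hcard S (Finset.mem_powersetCard.1 hS).2,
      Finset.sum_const, Finset.card_powersetCard, Finset.card_univ, Fintype.card_fin,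
      smul_eq_mul] at h
  have hchoose : 2 * n.choose 2 = n * (n - 1) := by
    rw [Nat.choose_two_right, Nat.mul_div_cancel' (Nat.even_mul_pred_self n).two_dvd]
  obtain ⟨k, rfl⟩ : ∃ k, n = k + 1 := ⟨n - 1, by omega⟩
  rw [Nat.add_sub_cancel] at hchoose hdim
  have hm1 : m ≤ 1 := by
    by_contra! hm2
    nlinarith [Nat.mul_le_mul_left ((k + 1).choose 2) hm2]
  obtain ⟨T, hT⟩ := exists_perm_representation ρ (Nat.succ_pos k)
  suffices h : ∃ σ : Equiv.Perm (Fin (k + 1)), σ a = b ∧ T σ ⟨v, hv⟩ = ⟨v, hv⟩ by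
    obtain ⟨σ, hσ, hfix⟩ := h
    obtain ⟨g, hg⟩ := exists_isSignedPerm (Nat.succ_pos k) σ
    exact ⟨σ, g, hσ, hg, by rw [← hT σ g hg ⟨v, hv⟩, hfix]⟩
  have hker {i j : Fin (k + 1)} (hij : i ≠ j) :
      ∃ f : signWeightSpace ρ ∅ →ₗ[ℝ] signWeightSpace ρ {i, j},
        ∀ x, f x = 0 → T (Equiv.swap i j) x = x := by
    obtain ⟨f, hf⟩ := exists_linearMap_signWeightSpace_pair ρ hij
    obtain ⟨g, hg⟩ := exists_isSignedPerm (Nat.succ_pos k) (Equiv.swap i j)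
    exact ⟨f, fun x hx => Subtype.ext ((hT _ g hg x).trans (hf x hx g hg))⟩
  rcases Nat.le_one_iff_eq_zero_or_eq_one.1 hm1 with hm0 | hm1'
  · obtain ⟨f, hf⟩ := hker hab
    refine ⟨Equiv.swap a b, Equiv.swap_apply_left a b, hf _ ?_⟩
    have := Module.finrank_zero_iff.1 (hm.symm.trans hm0)
    exact Subsingleton.elim _ _
  · rw [hm1'] at hsum
    refine exists_perm_fixing_of_finrank_lt T (by rw [Fintype.card_fin]; omega)
      (by rw [Fintype.card_fin]; nlinarith) (fun i j hij => ?_) _ a b hab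
    obtain ⟨f, hf⟩ := hker hij
    exact exists_eq_add_smul_of_ker_le ((hcard _ (Finset.card_pair hij)).trans_le hm1) f _ hf

end SmallRepresentations

/-- Let `n ≥ 17`, `p ≥ 1`, let `n₁, …, n_{p+1}` be positive integers summing
to `n` (encoded by the monotone block function `blk` with fibers of cardinality `nn i`),
`a₁, …, a_{p+1}` pairwise distinct reals, `D = diag(a₁ I_{n₁}, …, a_{p+1} I_{n_{p+1}})` and
`M = {Q D Qᵀ : Q ∈ SO_n(ℝ)}` the isospectral model of the flag manifold.  If `(V, ρ)` is a
finite-dimensional continuous real representation of `SO_n(ℝ)` (realized on `V = ℝᵈ`, with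
`ρ` a continuous homomorphism into invertible `d × d` matrices) and `ε : M → V` is an
injective continuous `SO_n(ℝ)`-equivariant map, then `dim V ≥ (n−1)(n+2)/2`, i.e.
`(n−1)(n+2) ≤ 2d`. -/
theorem dim_ge_of_equivariant_embedding_of_flag
    (n p : ℕ) (hn : 17 ≤ n) (hp : 1 ≤ p)
    (nn : Fin (p + 1) → ℕ) (hpos : ∀ i, 0 < nn i) (hsum : ∑ i, nn i = n)
    (blk : Fin n → Fin (p + 1)) (hmono : Monotone blk)
    (hfib : ∀ i, (Finset.univ.filter fun j => blk j = i).card = nn i)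
    (a : Fin (p + 1) → ℝ) (ha : Function.Injective a)
    (D : Matrix (Fin n) (Fin n) ℝ) (hD : D = Matrix.diagonal fun j => a (blk j))
    (M : Set (Matrix (Fin n) (Fin n) ℝ)) (hM : M = {X | ∃ Q ∈ SOn n, X = Q * D * Qᵀ})
    (d : ℕ) (ρ : Matrix (Fin n) (Fin n) ℝ → Matrix (Fin d) (Fin d) ℝ)
    (hρ1 : ρ 1 = 1)
    (hρmul : ∀ Q ∈ SOn n, ∀ R ∈ SOn n, ρ (Q * R) = ρ Q * ρ R)
    (hρunit : ∀ Q ∈ SOn n, IsUnit (ρ Q))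
    (hρcont : ContinuousOn ρ (SOn n))
    (ε : Matrix (Fin n) (Fin n) ℝ → Fin d → ℝ)
    (hεinj : Set.InjOn ε M) (hεcont : ContinuousOn ε M)
    (hεeqv : ∀ Q ∈ SOn n, ∀ X ∈ M, ε (Q * X * Qᵀ) = (ρ Q).mulVec (ε X)) :
    (n - 1) * (n + 2) ≤ 2 * d := by
  by_contra! hlt
  have hDM : D ∈ M := by
    rw [hM]
    exact ⟨1, ⟨by simp, by simp⟩, by simp⟩
  let ρ' : Representation ℝ (specialOrthogonal n) (Fin d → ℝ) :=
    { toFun := fun g => (ρ g.1).mulVecLin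
      map_one' := by
        rw [Submonoid.coe_one, hρ1, Matrix.mulVecLin_one]
        rfl
      map_mul' := fun g h => by
        rw [Submonoid.coe_mul, hρmul _ g.2 _ h.2, Matrix.mulVecLin_mul]
        rfl }
  have hρ' (g : specialOrthogonal n) : ρ' g (ε D) = ε (g.1 * D * g.1ᵀ) :=
    (hεeqv g.1 g.2 D hDM).symm
  have hv : ε D ∈ signWeightSpace ρ' ∅ := by
    rw [mem_signWeightSpace]
    intro s
    rw [hρ', coe_signDiag, hD]
    have h (i : Fin n) : ((s.1 i : ℤ) : ℝ) * a (blk i) * ((s.1 i : ℤ) : ℝ) = a (blk i) := by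
      rw [mul_right_comm, units_cast_mul_self, one_mul]
    simp [signChar, h]
  obtain ⟨i, j, hij⟩ : ∃ i j : Fin n, blk i ≠ blk j := by
    have hne (q : Fin (p + 1)) : ∃ j, blk j = q := by
      have h := hfib q ▸ hpos q
      obtain ⟨j, hj⟩ := Finset.card_pos.1 h
      exact ⟨j, (Finset.mem_filter.1 hj).2⟩
    obtain ⟨i, hi⟩ := hne 0
    obtain ⟨j, hj⟩ := hne (Fin.last p)
    refine ⟨i, j, ?_⟩
    rw [hi, hj]
    intro h
    have h' : 0 = p := congrArg Fin.val h
    omega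
  obtain ⟨σ, g, hσ, ⟨t, ht⟩, hfix⟩ := exists_isSignedPerm_apply_eq ρ' (by omega)
    (by simpa using hlt) hv (a := i) (b := j) (fun h => hij (congrArg blk h))
  rw [hρ'] at hfix
  have hgD : g.1 * D * g.1ᵀ = D :=
    hεinj (by rw [hM]; exact ⟨g.1, g.2, rfl⟩) hDM hfix
  have hcomm : g.1 * D = D * g.1 := by
    calc g.1 * D = g.1 * D * (g.1ᵀ * g.1) := by rw [g.2.1, Matrix.mul_one]
      _ = D * g.1 := by rw [← Matrix.mul_assoc, hgD]
  have hentry := congrFun (congrFun hcomm j) i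
  rw [hD, mul_diagonal, diagonal_mul, ht, if_pos hσ.symm, mul_comm] at hentry
  have ht0 : ((t i : ℤ) : ℝ) ≠ 0 := left_ne_zero_of_mul_eq_one (units_cast_mul_self (t i))
  exact hij (ha (mul_right_cancel₀ ht0 hentry))
end

section
/- Let n ≥ 17, p ≥ 1, let n₁,…,n_{p+1} be positive integers with n₁+⋯+n_{p+1} = n, let a₁,…,a_{p+1} be pairwise distinct real numbers, and let D = diag(a₁I_{n₁},…,a_{p+1}I_{n_{p+1}}) and M = {QDQᵀ : Q ∈ SO_n(ℝ)}. If (V,ρ) is a finite-dimensional continuous real representation of SO_n(ℝ) with dim V = (n−1)(n+2)/2 and there exists an injective continuous SO_n(ℝ)-equivariant map ε : M → V, then V is isomorphic as an SO_n(ℝ)-representation to Sym²₀(ℝⁿ) equipped with the conjugation action Q·X = QXQᵀ; i.e., there is a linear bijection V → Sym²₀(ℝⁿ) intertwining the two actions. -/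
open Matrix Topology

/-- `Sym²₀(ℝⁿ)`: the space of real symmetric traceless `n × n` matrices, as a subspace of
the space of all `n × n` real matrices. -/
def symTraceless (n : ℕ) : Submodule ℝ (Matrix (Fin n) (Fin n) ℝ) where
  carrier := {X | Xᵀ = X ∧ X.trace = 0}
  add_mem' := fun hX hY =>
    ⟨by rw [Matrix.transpose_add, hX.1, hY.1], by rw [Matrix.trace_add, hX.2, hY.2, add_zero]⟩
  zero_mem' := ⟨by simp, by simp⟩
  smul_mem' := fun c X hX =>
    ⟨by rw [Matrix.transpose_smul, hX.1], by rw [Matrix.trace_smul, hX.2, smul_zero]⟩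

set_option linter.unusedSectionVars false

namespace FlagEmbedding

section Rotation

variable {ι : Type*} [Fintype ι] [DecidableEq ι]

/-- The rotation by `θ` in the plane spanned by an orthonormal pair `x`, `y`. -/
noncomputable def planeRot (x y : ι → ℝ) (θ : ℝ) : Matrix ι ι ℝ :=
  1 + (Real.cos θ - 1) • (vecMulVec x x + vecMulVec y y)
    + Real.sin θ • (vecMulVec y x - vecMulVec x y)

lemma planeRot_mul (x y : ι → ℝ) (hx : x ⬝ᵥ x = 1) (hy : y ⬝ᵥ y = 1) (hxy : x ⬝ᵥ y = 0)
    (θ φ : ℝ) : planeRot x y θ * planeRot x y φ = planeRot x y (θ + φ) := by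
  have hyx : y ⬝ᵥ x = 0 := by rw [dotProduct_comm]; exact hxy
  simp only [planeRot, add_mul, mul_add, sub_mul, mul_sub, smul_mul_assoc, mul_smul_comm, one_mul,
    mul_one, vecMulVec_mul_vecMulVec, hx, hy, hxy, hyx, one_smul, zero_smul, vecMulVec_zero,
    Real.cos_add, Real.sin_add, smul_add, smul_sub, smul_smul]
  module

lemma planeRot_zero (x y : ι → ℝ) : planeRot x y 0 = 1 := by simp [planeRot]

lemma planeRot_transpose (x y : ι → ℝ) (θ : ℝ) :
    (planeRot x y θ)ᵀ = planeRot x y (-θ) := by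
  simp only [planeRot, transpose_add, transpose_smul, transpose_sub, transpose_one,
    transpose_vecMulVec, Real.cos_neg, Real.sin_neg]
  module

lemma planeRot_conj (Q : Matrix ι ι ℝ) (hQ : Q * Qᵀ = 1) (x y : ι → ℝ) (θ : ℝ) :
    Q * planeRot x y θ * Qᵀ = planeRot (Q *ᵥ x) (Q *ᵥ y) θ := by
  simp only [planeRot, mul_add, add_mul, mul_sub, sub_mul, mul_smul_comm, smul_mul_assoc,
    mul_vecMulVec, vecMulVec_mul, vecMul_transpose, mul_one, hQ]

lemma planeRot_sign_smul (x y : ι → ℝ) (a b θ : ℝ) (ha : a = 1 ∨ a = -1) (hb : b = 1 ∨ b = -1) :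
    planeRot (a • x) (b • y) θ = planeRot x y (a * b * θ) := by
  rcases ha with rfl | rfl <;> rcases hb with rfl | rfl <;>
    simp [planeRot, vecMulVec_neg, neg_vecMulVec] <;> module

lemma planeRot_comm (x y : ι → ℝ) (θ : ℝ) : planeRot y x θ = planeRot x y (-θ) := by
  simp only [planeRot, Real.cos_neg, Real.sin_neg]
  module

lemma planeRot_mem (x y : ι → ℝ) (hx : x ⬝ᵥ x = 1) (hy : y ⬝ᵥ y = 1) (hxy : x ⬝ᵥ y = 0)
    (θ : ℝ) : planeRot x y θ ∈ specialOrthogonalGroup ι ℝ := by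
  have key : ∀ θ, planeRot x y θ * (planeRot x y θ)ᵀ = 1 := fun θ => by
    rw [planeRot_transpose, planeRot_mul x y hx hy hxy, add_neg_cancel, planeRot_zero]
  rw [mem_specialOrthogonalGroup_iff, mem_orthogonalGroup_iff]
  refine ⟨key θ, ?_⟩
  have h := congrArg det (key (θ / 2))
  rw [det_mul, det_transpose, det_one] at h
  rw [← add_halves θ, ← planeRot_mul x y hx hy hxy, det_mul, h]

/-- The special orthogonal group. -/
abbrev SO (ι : Type*) [Fintype ι] [DecidableEq ι] := specialOrthogonalGroup ι ℝ

lemma SO_mul_transpose (g : SO ι) : g.1 * g.1ᵀ = 1 :=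
  (mem_orthogonalGroup_iff _ _).1 (mem_specialOrthogonalGroup_iff.1 g.2).1

lemma SO_transpose_mul (g : SO ι) : g.1ᵀ * g.1 = 1 :=
  mul_eq_one_comm.1 (SO_mul_transpose g)

lemma SO_coe_inv (g : SO ι) : (g⁻¹).1 = g.1ᵀ := by
  have h : g.1 * (g⁻¹).1 = 1 := congrArg Subtype.val (mul_inv_cancel g)
  calc (g⁻¹).1 = g.1ᵀ * (g.1 * (g⁻¹).1) := by rw [← mul_assoc, SO_transpose_mul g, one_mul]
    _ = g.1ᵀ := by rw [h, mul_one]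

/-- The coordinate vector `e i`. -/
abbrev e (i : ι) : ι → ℝ := Pi.single i 1

lemma e_dot_self (i : ι) : e i ⬝ᵥ e i = 1 := by simp

lemma e_dot {i j : ι} (h : i ≠ j) : e i ⬝ᵥ e j = 0 := by simp [h]

/-- The rotation by `θ` in the coordinate plane `(i, j)`; it is `1` when `i = j`. -/
noncomputable def rot (i j : ι) (θ : ℝ) : SO ι :=
  if h : i = j then 1
  else ⟨planeRot (e i) (e j) θ, planeRot_mem _ _ (e_dot_self i) (e_dot_self j) (e_dot h) θ⟩

lemma rot_self (i : ι) (θ : ℝ) : rot i i θ = 1 := by simp [rot]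

lemma coe_rot {i j : ι} (h : i ≠ j) (θ : ℝ) : (rot i j θ).1 = planeRot (e i) (e j) θ := by
  simp [rot, h]

lemma rot_add (i j : ι) (θ φ : ℝ) : rot i j (θ + φ) = rot i j θ * rot i j φ := by
  by_cases h : i = j
  · simp [rot, h]
  · apply Subtype.ext
    simp only [Submonoid.coe_mul]
    rw [coe_rot h, coe_rot h, coe_rot h,
      planeRot_mul _ _ (e_dot_self i) (e_dot_self j) (e_dot h)]

lemma rot_zero (i j : ι) : rot i j 0 = 1 := by
  by_cases h : i = j
  · simp [rot, h]
  · apply Subtype.ext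
    rw [coe_rot h, planeRot_zero]
    rfl

lemma rot_neg (i j : ι) (θ : ℝ) : rot i j (-θ) = (rot i j θ)⁻¹ := by
  rw [eq_inv_iff_mul_eq_one, ← rot_add, neg_add_cancel, rot_zero]

lemma rot_swap (i j : ι) (θ : ℝ) : rot j i θ = rot i j (-θ) := by
  by_cases h : i = j
  · simp [rot, h]
  · apply Subtype.ext
    rw [coe_rot h, coe_rot (Ne.symm h), planeRot_comm]

lemma rot_conj (g : SO ι) {i j k l : ι} (hij : i ≠ j) (hkl : k ≠ l) {a b : ℝ}
    (ha : a = 1 ∨ a = -1) (hb : b = 1 ∨ b = -1)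
    (hi : g.1 *ᵥ e i = a • e k) (hj : g.1 *ᵥ e j = b • e l) (θ : ℝ) :
    g * rot i j θ * g⁻¹ = rot k l (a * b * θ) := by
  apply Subtype.ext
  simp only [Submonoid.coe_mul]
  rw [coe_rot hij, coe_rot hkl, SO_coe_inv, planeRot_conj _ (SO_mul_transpose g), hi, hj,
    planeRot_sign_smul _ _ _ _ _ ha hb]

lemma rot_mulVec {i j : ι} (h : i ≠ j) (θ : ℝ) (x : ι → ℝ) :
    (rot i j θ).1 *ᵥ x = x + ((Real.cos θ - 1) * x i - Real.sin θ * x j) • e i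
      + ((Real.cos θ - 1) * x j + Real.sin θ * x i) • e j := by
  rw [coe_rot h, planeRot]
  simp only [add_mulVec, sub_mulVec, smul_mulVec, one_mulVec, vecMulVec_mulVec,
    single_one_dotProduct, op_smul_eq_smul]
  module

lemma rot_mulVec_left {i j : ι} (h : i ≠ j) (θ : ℝ) :
    (rot i j θ).1 *ᵥ e i = Real.cos θ • e i + Real.sin θ • e j := by
  rw [rot_mulVec h]
  simp [h]
  module

lemma rot_mulVec_right {i j : ι} (h : i ≠ j) (θ : ℝ) :
    (rot i j θ).1 *ᵥ e j = -Real.sin θ • e i + Real.cos θ • e j := by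
  rw [rot_mulVec h]
  simp [Ne.symm h]
  module

lemma rot_mulVec_of_ne {i j k : ι} (hki : k ≠ i) (hkj : k ≠ j) (θ : ℝ) :
    (rot i j θ).1 *ᵥ e k = e k := by
  by_cases h : i = j
  · subst h
    rw [rot_self, OneMemClass.coe_one, one_mulVec]
  · rw [rot_mulVec h]; simp [hki.symm, hkj.symm]

lemma continuous_rot (i j : ι) : Continuous (rot i j : ℝ → SO ι) := by
  by_cases h : i = j
  · have : (rot i j : ℝ → SO ι) = fun _ => 1 := by ext1 θ; simp [rot, h]
    rw [this]; exact continuous_const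
  · rw [continuous_induced_rng]
    have : (Subtype.val ∘ rot i j : ℝ → Matrix ι ι ℝ) = planeRot (e i) (e j) := by
      ext1 θ; exact coe_rot h θ
    rw [this]
    unfold planeRot
    fun_prop

/-- Diagonal sign matrices of determinant one. -/
def IsSign (t : SO ι) (ε : ι → ℝ) : Prop :=
  t.1 = diagonal ε

lemma IsSign.mulVec {t : SO ι} {ε : ι → ℝ} (h : IsSign t ε) (i : ι) :
    t.1 *ᵥ e i = ε i • e i := by
  rw [h]
  ext j
  by_cases hj : j = i
  · subst hj; simp
  · simp [hj]

lemma IsSign.sign {t : SO ι} {ε : ι → ℝ} (h : IsSign t ε) (i : ι) : ε i = 1 ∨ ε i = -1 := by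
  have h1 := SO_mul_transpose t
  rw [h, diagonal_transpose, diagonal_mul_diagonal, ← diagonal_one] at h1
  exact mul_self_eq_one_iff.1 (congrFun (diagonal_injective h1) i)

lemma IsSign.rot_conj {t : SO ι} {ε : ι → ℝ} (h : IsSign t ε) (i j : ι) (θ : ℝ) :
    t * rot i j θ = rot i j (ε i * ε j * θ) * t := by
  by_cases hij : i = j
  · subst hij; simp [rot_self]
  · rw [← FlagEmbedding.rot_conj t hij hij (h.sign i) (h.sign j) (h.mulVec i) (h.mulVec j) θ]
    group

lemma isSign_rot_pi {i j : ι} (h : i ≠ j) :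
    IsSign (rot i j Real.pi) (fun k => if k = i ∨ k = j then -1 else 1) := by
  unfold IsSign
  apply ext_of_mulVec_single
  intro k
  change _ *ᵥ e k = _ *ᵥ e k
  by_cases hk : k = i
  · subst hk
    rw [rot_mulVec_left h]
    ext l
    by_cases hl : l = k <;> simp [hl]
  by_cases hk' : k = j
  · subst hk'
    rw [rot_mulVec_right h]
    ext l
    by_cases hl : l = k <;> simp [hl]
  rw [rot_mulVec_of_ne hk hk']
  ext l
  by_cases hl : l = k <;> simp [hl, hk, hk']

end Rotation

section Generation

variable {ι : Type*} [Fintype ι] [DecidableEq ι]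

/-- The subgroup generated by the rotations in coordinate planes with indices in `A`. -/
def rotGroup (A : Finset ι) : Subgroup (SO ι) :=
  Subgroup.closure {g | ∃ i ∈ A, ∃ j ∈ A, ∃ θ, g = rot i j θ}

lemma rot_mem_rotGroup {A : Finset ι} {i j : ι} (hi : i ∈ A) (hj : j ∈ A) (θ : ℝ) :
    rot i j θ ∈ rotGroup A :=
  Subgroup.subset_closure ⟨i, hi, j, hj, θ, rfl⟩

lemma rotGroup_mono {A B : Finset ι} (h : A ⊆ B) : rotGroup A ≤ rotGroup B :=
  Subgroup.closure_mono fun _ ⟨i, hi, j, hj, θ, hg⟩ => ⟨i, h hi, j, h hj, θ, hg⟩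

/-- The stabilizer of a vector in the special orthogonal group. -/
def vecStab (x : ι → ℝ) : Subgroup (SO ι) where
  carrier := {g | g.1 *ᵥ x = x}
  mul_mem' {g h} hg hh := by
    simp only [Set.mem_ofPred_eq, Submonoid.coe_mul] at *
    rw [← mulVec_mulVec, hh, hg]
  one_mem' := by simp
  inv_mem' {g} hg := by
    simp only [Set.mem_ofPred_eq] at *
    conv_lhs => rw [← hg, SO_coe_inv, mulVec_mulVec, SO_transpose_mul, one_mulVec]

lemma mem_vecStab {x : ι → ℝ} {g : SO ι} : g ∈ vecStab x ↔ g.1 *ᵥ x = x := Iff.rfl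

lemma rotGroup_le_vecStab {A : Finset ι} {k : ι} (hk : k ∉ A) : rotGroup A ≤ vecStab (e k) := by
  refine (Subgroup.closure_le _).2 ?_
  rintro _ ⟨i, hi, j, hj, θ, rfl⟩
  exact rot_mulVec_of_ne (ne_of_mem_of_not_mem hi hk).symm (ne_of_mem_of_not_mem hj hk).symm θ

lemma SO_dot (g : SO ι) (x y : ι → ℝ) : (g.1 *ᵥ x) ⬝ᵥ (g.1 *ᵥ y) = x ⬝ᵥ y := by
  rw [dotProduct_mulVec, vecMul_mulVec, SO_transpose_mul, vecMul_one]

lemma exists_rotGroup_mulVec_eq_smul (k : ι) (B : Finset ι) (hk : k ∉ B) :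
    ∀ x : ι → ℝ, (∀ i, i ≠ k → i ∉ B → x i = 0) →
      ∃ g ∈ rotGroup (insert k B), ∃ r : ℝ, g.1 *ᵥ x = r • e k := by
  induction B using Finset.induction_on with
  | empty =>
    intro x hx
    refine ⟨1, one_mem _, x k, ?_⟩
    ext i
    by_cases hi : i = k
    · subst hi; simp
    · simp [hi, hx i hi]
  | insert b B hb ih =>
    intro x hx
    have hkb : k ≠ b := fun h => hk (h ▸ Finset.mem_insert_self b B)
    set z : ℂ := ⟨x k, x b⟩ with hz
    have h1 : ‖z‖ * Real.cos z.arg = x k := Complex.norm_mul_cos_arg z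
    have h2 : ‖z‖ * Real.sin z.arg = x b := Complex.norm_mul_sin_arg z
    obtain ⟨g, hg, r, hr⟩ := ih (fun h => hk (Finset.mem_insert_of_mem h))
      ((rot k b (-z.arg)).1 *ᵥ x) (by
        intro i hik hiB
        rw [rot_mulVec hkb]
        by_cases hib : i = b
        · subst hib
          simp [hik, -neg_mul]
          rw [← h1, ← h2]; ring
        · simp [hik, hib, hx i hik (by simp [hib, hiB])])
    refine ⟨g * rot k b (-z.arg), mul_mem (rotGroup_mono ?_ hg)
      (rot_mem_rotGroup (by simp) (by simp) _), r, ?_⟩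
    · exact Finset.insert_subset_insert _ (Finset.subset_insert _ _)
    · rw [Submonoid.coe_mul, ← mulVec_mulVec, hr]

lemma exists_rotGroup_mulVec_eq_nonneg_smul (k : ι) (B : Finset ι) (hk : k ∉ B)
    (hB : B.Nonempty) (x : ι → ℝ) (hx : ∀ i, i ≠ k → i ∉ B → x i = 0) :
    ∃ g ∈ rotGroup (insert k B), ∃ r : ℝ, 0 ≤ r ∧ g.1 *ᵥ x = r • e k := by
  obtain ⟨g, hg, r, hr⟩ := exists_rotGroup_mulVec_eq_smul k B hk x hx
  rcases le_total 0 r with h0 | h0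
  · exact ⟨g, hg, r, h0, hr⟩
  · obtain ⟨b, hb⟩ := hB
    have hkb : k ≠ b := fun h => hk (h ▸ hb)
    refine ⟨rot k b Real.pi * g, mul_mem (rot_mem_rotGroup (by simp) (by simp [hb]) _) hg, -r,
      by linarith, ?_⟩
    rw [Submonoid.coe_mul, ← mulVec_mulVec, hr, mulVec_smul, rot_mulVec_left hkb]
    simp

lemma mem_rotGroup_of_fix (A : Finset ι) :
    ∀ g : SO ι, (∀ i, i ∉ A → g.1 *ᵥ e i = e i) → g ∈ rotGroup A := by
  induction A using Finset.induction_on with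
  | empty =>
    intro g hg
    have : g = 1 := by
      apply Subtype.ext
      apply ext_of_mulVec_single
      intro i
      rw [OneMemClass.coe_one, one_mulVec]
      exact hg i (by simp)
    rw [this]
    exact one_mem _
  | insert a A ha ih =>
    intro g hg
    have hx : ∀ i, i ≠ a → i ∉ A → (g.1 *ᵥ e a) i = 0 := by
      intro i hia hiA
      have h1 := SO_dot g (e i) (e a)
      rw [hg i (by simp [hia, hiA]), e_dot hia] at h1
      simpa using h1
    rcases A.eq_empty_or_nonempty with rfl | hA
    · have hd : g.1 = diagonal (fun i => if i = a then (g.1 *ᵥ e a) a else 1) := by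
        apply ext_of_mulVec_single
        intro i
        change g.1 *ᵥ e i = _ *ᵥ e i
        by_cases hi : i = a
        · subst hi
          ext j
          by_cases hj : j = i
          · subst hj; simp
          · rw [hx j hj (by simp)]; simp [hj]
        · rw [hg i (by simp [hi])]
          ext j
          by_cases hj : j = i <;> simp [hj, hi]
      have hdet := (mem_specialOrthogonalGroup_iff.1 g.2).2
      rw [hd, det_diagonal, Finset.prod_ite_eq' Finset.univ a, if_pos (Finset.mem_univ a)] at hdet
      have : g = 1 := by
        apply Subtype.ext
        rw [hd, OneMemClass.coe_one, ← diagonal_one]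
        congr 1
        ext i
        simp only [hdet, ite_self]
      rw [this]
      exact one_mem _
    · obtain ⟨h, hh, r, hr0, hr⟩ :=
        exists_rotGroup_mulVec_eq_nonneg_smul a A ha hA (g.1 *ᵥ e a) hx
      have hr1 : r = 1 := by
        have h1 := SO_dot (h * g) (e a) (e a)
        rw [Submonoid.coe_mul, ← mulVec_mulVec, hr] at h1
        simp at h1
        nlinarith
      have hmem : h * g ∈ rotGroup A := by
        apply ih
        intro i hi
        rw [Submonoid.coe_mul, ← mulVec_mulVec]
        by_cases hia : i = a
        · rw [hia, hr, hr1, one_smul]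
        · have hi' : i ∉ insert a A := by simp [hia, hi]
          rw [hg i hi']
          exact rotGroup_le_vecStab hi' hh
      have := mul_mem (inv_mem hh) (rotGroup_mono (Finset.subset_insert a A) hmem)
      simpa using this

lemma mem_of_mulVec_e_eq (K : Subgroup (SO ι)) (p : ι)
    (hK : ∀ j k, j ≠ p → k ≠ p → ∀ θ, rot j k θ ∈ K) (g : SO ι) (hg : g.1 *ᵥ e p = e p) :
    g ∈ K := by
  have h1 : g ∈ rotGroup (Finset.univ.erase p) := by
    apply mem_rotGroup_of_fix
    intro i hi
    have : i = p := by simpa using hi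
    rw [this, hg]
  have h2 : rotGroup (Finset.univ.erase p) ≤ K := by
    refine (Subgroup.closure_le _).2 ?_
    rintro _ ⟨i, hi, j, hj, θ, rfl⟩
    exact hK i j (by simpa using hi) (by simpa using hj) θ
  exact h2 h1

lemma exists_smul_e_eq (p : ι) (x : ι → ℝ) : ∃ (g : SO ι) (r : ℝ), g.1 *ᵥ (r • e p) = x := by
  obtain ⟨g, -, r, hr⟩ := exists_rotGroup_mulVec_eq_smul p (Finset.univ.erase p) (by simp) x
    (by intro i hi hi'; simp [hi] at hi')
  refine ⟨g⁻¹, r, ?_⟩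
  rw [← hr, mulVec_mulVec, SO_coe_inv, SO_transpose_mul, one_mulVec]

/-- A vector can be moved into a coordinate half-plane by an element fixing the first axis. -/
lemma exists_vecStab_mulVec_eq {p q : ι} (hpq : p ≠ q) (hcard : 3 ≤ Fintype.card ι)
    (x : ι → ℝ) : ∃ g ∈ vecStab (e p), ∃ r : ℝ, 0 ≤ r ∧ g.1 *ᵥ x = x p • e p + r • e q := by
  have hB : ((Finset.univ.erase p).erase q).Nonempty := by
    rw [← Finset.card_pos, Finset.card_erase_of_mem (by simp [hpq.symm]),
      Finset.card_erase_of_mem (by simp), Finset.card_univ]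
    omega
  obtain ⟨g, hg, r, hr0, hr⟩ := exists_rotGroup_mulVec_eq_nonneg_smul q
    ((Finset.univ.erase p).erase q) (by simp) hB (x - x p • e p) (by
      intro i hi hi'
      have : i = p := by simpa [hi] using hi'
      simp [this])
  have hgp : g ∈ vecStab (e p) := rotGroup_le_vecStab (by simp [hpq]) hg
  refine ⟨g, hgp, r, hr0, ?_⟩
  rw [mulVec_sub, mulVec_smul, mem_vecStab.1 hgp] at hr
  rw [← hr]; abel

lemma exists_pair_eq {p q : ι} (hpq : p ≠ q) (hcard : 3 ≤ Fintype.card ι) (x y : ι → ℝ) :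
    ∃ (g : SO ι) (a b c : ℝ), g.1 *ᵥ (a • e p) = x ∧ g.1 *ᵥ (b • e p + c • e q) = y := by
  obtain ⟨g, a, rfl⟩ := exists_smul_e_eq p x
  obtain ⟨h, hh, c, -, hc⟩ := exists_vecStab_mulVec_eq hpq hcard (g.1ᵀ *ᵥ y)
  refine ⟨g * h⁻¹, a, (g.1ᵀ *ᵥ y) p, c, ?_, ?_⟩
  · rw [Submonoid.coe_mul, ← mulVec_mulVec, mulVec_smul, mem_vecStab.1 (inv_mem hh)]
  · rw [← hc, Submonoid.coe_mul, ← mulVec_mulVec, mulVec_mulVec (M := h⁻¹.1), SO_coe_inv,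
      SO_transpose_mul, one_mulVec, mulVec_mulVec, SO_mul_transpose, one_mulVec]

end Generation

section Weights

variable {ι : Type*} [Fintype ι] [DecidableEq ι]
  {V : Type*} [NormedAddCommGroup V] [NormedSpace ℝ V] [FiniteDimensional ℝ V]
  (π : Representation ℝ (SO ι) V)

lemma rep_inv_apply (g : SO ι) (v : V) : π g⁻¹ (π g v) = v := by
  rw [← Module.End.mul_apply, ← map_mul, inv_mul_cancel, map_one, Module.End.one_apply]

lemma rep_injective (g : SO ι) : Function.Injective (π g) :=
  Function.LeftInverse.injective (rep_inv_apply π g)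

lemma rep_rot_rot (i j : ι) (θ φ : ℝ) (v : V) :
    π (rot i j θ) (π (rot i j φ) v) = π (rot i j (θ + φ)) v := by
  rw [rot_add, map_mul, Module.End.mul_apply]

/-- The vectors fixed by all diagonal sign matrices of determinant one. -/
def signFixed : Submodule ℝ V where
  carrier := {v | ∀ t ε, IsSign t ε → π t v = v}
  add_mem' := fun ha hb t ε h => by rw [map_add, ha t ε h, hb t ε h]
  zero_mem' := fun _ _ _ => map_zero _
  smul_mem' := fun c v hv t ε h => by rw [map_smul, hv t ε h]

/-- The weight space of the diagonal sign matrices for the character `ε ↦ ε i * ε j`. -/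
def weightSpace (i j : ι) : Submodule ℝ V where
  carrier := {v | ∀ t ε, IsSign t ε → π t v = (ε i * ε j) • v}
  add_mem' := fun ha hb t ε h => by rw [map_add, ha t ε h, hb t ε h, smul_add]
  zero_mem' := fun _ _ _ => by rw [map_zero, smul_zero]
  smul_mem' := fun c v hv t ε h => by rw [map_smul, hv t ε h, smul_comm]

variable {π}

lemma IsSign.rep_rot {t : SO ι} {ε : ι → ℝ} (h : IsSign t ε) (i j : ι) (θ : ℝ) (v : V) :
    π t (π (rot i j θ) v) = π (rot i j (ε i * ε j * θ)) (π t v) := by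
  rw [← Module.End.mul_apply, ← map_mul, h.rot_conj, map_mul, Module.End.mul_apply]

lemma IsSign.mul_sign {t : SO ι} {ε : ι → ℝ} (h : IsSign t ε) (i j : ι) :
    ε i * ε j = 1 ∨ ε i * ε j = -1 := by
  rcases h.sign i with hi | hi <;> rcases h.sign j with hj | hj <;> simp [hi, hj]

lemma rot_sub_mem_weightSpace {v : V} (hv : v ∈ signFixed π) (i j : ι) (θ : ℝ) :
    π (rot i j θ) v - π (rot i j (-θ)) v ∈ weightSpace π i j := by
  intro t ε h
  rw [map_sub, h.rep_rot, h.rep_rot, hv t ε h]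
  rcases h.mul_sign i j with h1 | h1 <;> simp [h1]

lemma rot_add_mem_signFixed {v : V} (hv : v ∈ signFixed π) (i j : ι) (θ : ℝ) :
    π (rot i j θ) v + π (rot i j (-θ)) v ∈ signFixed π := by
  intro t ε h
  rw [map_add, h.rep_rot, h.rep_rot, hv t ε h]
  rcases h.mul_sign i j with h1 | h1 <;> simp [h1, add_comm]

variable (π) in
/-- The action of the transposition `(i j)`, lifted to a quarter turn. -/
noncomputable def swapOp (i j : ι) : V →ₗ[ℝ] V := π (rot i j (Real.pi / 2))

lemma rot_pi_apply {v : V} (hv : v ∈ signFixed π) (i j : ι) : π (rot i j Real.pi) v = v := by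
  by_cases h : i = j
  · subst h; simp [rot_self]
  · exact hv _ _ (isSign_rot_pi h)

lemma swapOp_swapOp {v : V} (hv : v ∈ signFixed π) (i j : ι) :
    swapOp π i j (swapOp π i j v) = v := by
  rw [swapOp, rep_rot_rot, add_halves, rot_pi_apply hv]

lemma rot_neg_half_pi {v : V} (hv : v ∈ signFixed π) (i j : ι) :
    π (rot i j (-(Real.pi / 2))) v = swapOp π i j v := by
  conv_lhs => rw [← rot_pi_apply hv i j, rep_rot_rot]
  rw [swapOp]
  congr 3
  ring

lemma swapOp_mem {v : V} (hv : v ∈ signFixed π) (i j : ι) : swapOp π i j v ∈ signFixed π := by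
  intro t ε h
  rw [swapOp, h.rep_rot, hv t ε h]
  rcases h.mul_sign i j with h1 | h1
  · simp [h1]
  · rw [h1, neg_one_mul, rot_neg_half_pi hv, swapOp]

lemma swapOp_comm {v : V} (hv : v ∈ signFixed π) (i j : ι) : swapOp π j i v = swapOp π i j v := by
  rw [swapOp, rot_swap, rot_neg_half_pi hv]

lemma swapOp_self (i : ι) (v : V) : swapOp π i i v = v := by
  simp [swapOp, rot_self]

lemma half_pi_left {i j : ι} (h : i ≠ j) : (rot i j (Real.pi / 2)).1 *ᵥ e i = (1 : ℝ) • e j := by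
  rw [rot_mulVec_left h]; simp

lemma half_pi_right {i j : ι} (h : i ≠ j) :
    (rot i j (Real.pi / 2)).1 *ᵥ e j = (-1 : ℝ) • e i := by
  rw [rot_mulVec_right h]; simp

lemma half_pi_of_ne {i j k : ι} (hi : k ≠ i) (hj : k ≠ j) :
    (rot i j (Real.pi / 2)).1 *ᵥ e k = (1 : ℝ) • e k := by
  rw [rot_mulVec_of_ne hi hj, one_smul]

lemma rep_conj {g h k : SO ι} (hg : g * h * g⁻¹ = k) (v : V) : π g (π h v) = π k (π g v) := by
  rw [← Module.End.mul_apply, ← Module.End.mul_apply, ← map_mul, ← map_mul, ← hg]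
  congr 2
  group

lemma swapOp_rot {i j k : ι} (hij : i ≠ j) (hik : i ≠ k) (hjk : j ≠ k) (θ : ℝ) (v : V) :
    swapOp π j k (π (rot i j θ) v) = π (rot i k θ) (swapOp π j k v) := by
  have h := rot_conj _ hij hik (Or.inl rfl) (Or.inl rfl) (half_pi_of_ne hij hik)
    (half_pi_left hjk) θ
  rw [mul_one, one_mul] at h
  exact rep_conj h v

lemma swapOp_braid {i j k : ι} (hij : i ≠ j) (hik : i ≠ k) (hjk : j ≠ k) (v : V) :
    swapOp π j k (swapOp π i j v) = swapOp π i k (swapOp π j k v) :=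
  swapOp_rot hij hik hjk _ v

lemma swapOp_rot_disjoint {i j k l : ι} (hik : i ≠ k) (hil : i ≠ l) (hjk : j ≠ k) (hjl : j ≠ l)
    (θ : ℝ) (v : V) : swapOp π k l (π (rot i j θ) v) = π (rot i j θ) (swapOp π k l v) := by
  by_cases hij : i = j
  · subst hij; simp [rot_self]
  · have h := rot_conj _ hij hij (Or.inl rfl) (Or.inl rfl) (half_pi_of_ne hik hil)
      (half_pi_of_ne hjk hjl) θ
    rw [mul_one, one_mul] at h
    exact rep_conj h v

lemma swapOp_mem_weightSpace {i j k : ι} (hij : i ≠ j) (hik : i ≠ k) (hjk : j ≠ k) {v : V}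
    (hv : v ∈ weightSpace π i j) : swapOp π j k v ∈ weightSpace π i k := by
  have hneg : π (rot j k (-(Real.pi / 2))) v = -swapOp π j k v := by
    have h1 := hv _ _ (isSign_rot_pi hjk)
    simp only [hij, hik, or_self, if_false, true_or, if_true] at h1
    have h2 : π (rot j k (-(Real.pi / 2))) (π (rot j k Real.pi) v) = swapOp π j k v := by
      rw [rep_rot_rot, swapOp]
      congr 3
      ring
    rw [h1] at h2
    rw [← h2]
    simp
  intro t ε h
  rw [swapOp, h.rep_rot, hv t ε h]
  have hij' := h.mul_sign i j
  have hcalc : ε i * ε k = (ε i * ε j) * (ε j * ε k) := by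
    rcases h.sign j with hj | hj <;> simp [hj]
  rw [hcalc]
  rcases h.mul_sign j k with h1 | h1
  · simp [h1]
  · rw [h1, neg_one_mul, map_smul, hneg, swapOp]
    simp

lemma weightSpace_comm (i j : ι) : weightSpace π i j = weightSpace π j i := by
  ext v
  exact forall_congr' fun t => forall_congr' fun ε => by rw [mul_comm]

lemma pair_transitive {P : ι → ι → Prop} (symm : ∀ i j, P i j → P j i)
    (move : ∀ i j k, i ≠ j → i ≠ k → j ≠ k → P i j → P i k) {i₀ j₀ : ι} (h₀ : i₀ ≠ j₀)
    (h : P i₀ j₀) {i j : ι} (hij : i ≠ j) : P i j := by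
  have move' : ∀ i j k, i ≠ j → i ≠ k → P i j → P i k := fun i j k hij hik hP => by
    by_cases hjk : j = k
    · exact hjk ▸ hP
    · exact move i j k hij hik hjk hP
  by_cases hj : i₀ = j
  · subst hj
    exact symm _ _ (move' _ _ _ h₀ hij.symm h)
  · exact symm _ _ (move' _ _ _ (Ne.symm hj) hij.symm (symm _ _ (move' _ _ _ h₀ hj h)))

lemma finrank_weightSpace_le {i j k l : ι} (hij : i ≠ j) (hkl : k ≠ l) :
    Module.finrank ℝ (weightSpace π i j) ≤ Module.finrank ℝ (weightSpace π k l) := by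
  refine pair_transitive (P := fun k l =>
    Module.finrank ℝ (weightSpace π i j) ≤ Module.finrank ℝ (weightSpace π k l)) ?_ ?_ hij
    le_rfl hkl
  · intro k l h
    rwa [weightSpace_comm l k]
  · intro k l m hkl hkm hlm h
    refine h.trans ?_
    refine LinearMap.finrank_le_finrank_of_injective (f := (swapOp π l m).restrict
      (p := weightSpace π k l) (q := weightSpace π k m)
      fun v hv => swapOp_mem_weightSpace hkl hkm hlm hv) ?_
    intro x y hxy
    exact Subtype.ext (rep_injective π _ (congrArg Subtype.val hxy))

end Weights

section Dimension

variable {ι : Type*} [Fintype ι] [DecidableEq ι]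
  {V : Type*} [NormedAddCommGroup V] [NormedSpace ℝ V] [FiniteDimensional ℝ V]
  {π : Representation ℝ (SO ι) V}

variable (ι) in
/-- The diagonal matrices of determinant one with entries `±1`. -/
abbrev SignIndex := {t : SO ι // IsSign t fun i => t.1 i i}

lemma IsSign.apply_self {t : SO ι} {ε : ι → ℝ} (h : IsSign t ε) (i : ι) : t.1 i i = ε i := by
  rw [h]; simp

lemma IsSign.isSign_diag {t : SO ι} {ε : ι → ℝ} (h : IsSign t ε) :
    IsSign t fun i => t.1 i i := by
  have : (fun i => t.1 i i) = ε := funext h.apply_self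
  rw [this]; exact h

/-- The character of the diagonal sign matrices attached to a set of indices. -/
def signChar (S : Finset ι) (t : SignIndex ι) : ℝ := ∏ i ∈ S, t.1.1 i i

lemma exists_notMem_finset (S : Finset ι) (h : S.card < Fintype.card ι) : ∃ i, i ∉ S := by
  by_contra! hc
  have : S = Finset.univ := Finset.eq_univ_iff_forall.2 hc
  rw [this, Finset.card_univ] at h
  exact lt_irrefl _ h

lemma signChar_injOn (hcard : 5 ≤ Fintype.card ι) {S S' : Finset ι} (hS : S.card = 2)
    (hS' : S'.card = 2) (h : signChar S = signChar S') : S = S' := by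
  by_contra hne
  have hsub : ¬ S ⊆ S' := fun hsub => hne (Finset.eq_of_subset_of_card_le hsub (by omega))
  obtain ⟨i, hi, hi'⟩ := Finset.not_subset.1 hsub
  obtain ⟨m, hm⟩ := exists_notMem_finset (S ∪ S')
    (lt_of_le_of_lt (Finset.card_union_le S S') (by omega))
  rw [Finset.mem_union, not_or] at hm
  have him : i ≠ m := fun h => hm.1 (h ▸ hi)
  have ht := isSign_rot_pi him
  have hval := congrFun h ⟨_, ht.isSign_diag⟩
  simp only [signChar, ht.apply_self] at hval
  rw [← Finset.mul_prod_erase S _ hi, Finset.prod_eq_one, Finset.prod_eq_one] at hval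
  · norm_num at hval
  · intro j hj
    have h1 : j ≠ i := fun h => hi' (h ▸ hj)
    have h2 : j ≠ m := fun h => hm.2 (h ▸ hj)
    simp [h1, h2]
  · intro j hj
    rw [Finset.mem_erase] at hj
    have h2 : j ≠ m := fun h => hm.1 (h ▸ hj.2)
    simp [hj.1, h2]

lemma finrank_weightSpace_le_one (hcard : 5 ≤ Fintype.card ι)
    (hV : Module.finrank ℝ V < 2 * (Fintype.card ι).choose 2) {i j : ι} (hij : i ≠ j) :
    Module.finrank ℝ (weightSpace π i j) ≤ 1 := by
  by_contra! hcon
  set J := {S : Finset ι // S ∈ Finset.powersetCard 2 Finset.univ}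
  have hind := Module.End.independent_iInf_maxGenEigenspace_of_forall_mapsTo
    (fun t : SignIndex ι => π t.1) (by
      intro t s φ
      apply Module.End.mapsTo_maxGenEigenspace_of_comm
      have : s.1 * t.1 = t.1 * s.1 := by
        apply Subtype.ext
        rw [Submonoid.coe_mul, Submonoid.coe_mul, show s.1.1 = _ from s.2,
          show t.1.1 = _ from t.2, diagonal_mul_diagonal, diagonal_mul_diagonal]
        simp only [mul_comm]
      rw [commute_iff_eq, ← map_mul, ← map_mul, this])
  have hind' := hind.comp (f := fun S : J => signChar S.1) (fun S S' h => Subtype.ext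
    (signChar_injOn hcard (Finset.mem_powersetCard.1 S.2).2 (Finset.mem_powersetCard.1 S'.2).2 h))
  have h1 := LinearMap.finrank_le_finrank_of_injective hind'.dfinsupp_lsum_injective
  have h2 := Module.finrank_directSum (R := ℝ) (fun S : J =>
    ↥(⨅ t : SignIndex ι, Module.End.maxGenEigenspace (π t.1) (signChar S.1 t)))
  have h3 : ∀ S : J, 2 ≤ Module.finrank ℝ
      ↥(⨅ t : SignIndex ι, Module.End.maxGenEigenspace (π t.1) (signChar S.1 t)) := by
    intro S
    obtain ⟨k, l, hkl, hS⟩ := Finset.card_eq_two.1 (Finset.mem_powersetCard.1 S.2).2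
    refine hcon.trans_le ((finrank_weightSpace_le hij hkl).trans (Submodule.finrank_mono ?_))
    refine le_iInf fun t => ?_
    intro v hv
    have hev : v ∈ Module.End.eigenspace (π t.1) (signChar S.1 t) := by
      rw [Module.End.mem_eigenspace_iff, signChar, hS, Finset.prod_pair hkl]
      exact hv _ _ t.2
    exact (Module.End.genEigenspace _ _).mono le_top hev
  have h4 := Finset.sum_le_sum (s := Finset.univ) fun S _ => h3 S
  rw [Finset.sum_const, Finset.card_univ] at h4
  have h5 : Fintype.card J = (Fintype.card ι).choose 2 := by
    rw [Fintype.card_coe, Finset.card_powersetCard, Finset.card_univ]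
  rw [h5, smul_eq_mul, ← h2] at h4
  have := h4.trans h1
  omega

lemma exists_smul_add_smul_eq_zero {W : Submodule ℝ V} (hW : Module.finrank ℝ W ≤ 1) {x y : V}
    (hx : x ∈ W) (hy : y ∈ W) : ∃ a b : ℝ, a ^ 2 + b ^ 2 = 1 ∧ a • x + b • y = 0 := by
  have hdep : ¬ LinearIndependent ℝ ![(⟨x, hx⟩ : W), ⟨y, hy⟩] := fun h => by
    have := h.fintype_card_le_finrank
    simp at this
    omega
  rw [LinearIndependent.pair_iff] at hdep
  push Not at hdep
  obtain ⟨a, b, hab, hne⟩ := hdep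
  have hab' : a • x + b • y = 0 := congrArg Subtype.val hab
  have hpos : 0 < a ^ 2 + b ^ 2 := by
    by_cases ha : a = 0
    · have := hne ha; positivity
    · positivity
  set r := √(a ^ 2 + b ^ 2)
  have hr : 0 < r := Real.sqrt_pos.2 hpos
  have hr2 : r ^ 2 = a ^ 2 + b ^ 2 := Real.sq_sqrt hpos.le
  refine ⟨r⁻¹ * a, r⁻¹ * b, ?_, ?_⟩
  · field_simp
    linarith
  · rw [mul_smul, mul_smul, ← smul_add, hab', smul_zero]

lemma rot_fixed_of_dyadic (hπ : ∀ v, Continuous fun g => π g v) {i j : ι} {z : V}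
    (hz : ∀ k : ℕ, π (rot i j (2 * Real.pi / 2 ^ k)) z = z) (θ : ℝ) : π (rot i j θ) z = z := by
  let S : AddSubgroup ℝ :=
    { carrier := {θ | π (rot i j θ) z = z}
      add_mem' := fun {a b} ha hb => by
        change π (rot i j (a + b)) z = z
        rw [← rep_rot_rot, show π (rot i j b) z = z from hb, show π (rot i j a) z = z from ha]
      zero_mem' := by change π (rot i j 0) z = z; simp [rot_zero]
      neg_mem' := fun {a} ha => by
        change π (rot i j (-a)) z = z
        conv_lhs => rw [← show π (rot i j a) z = z from ha]
        rw [rot_neg, rep_inv_apply] }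
  have hdense : Dense (S : Set ℝ) := by
    apply AddSubgroup.dense_of_not_isolated_zero
    intro ε hε
    obtain ⟨k, hk⟩ := pow_unbounded_of_one_lt (2 * Real.pi / ε) one_lt_two
    refine ⟨2 * Real.pi / 2 ^ k, hz k, by positivity, ?_⟩
    rw [div_lt_iff₀ (by positivity)]
    rw [div_lt_iff₀ hε] at hk
    linarith
  have hcl : IsClosed (S : Set ℝ) :=
    isClosed_eq ((hπ z).comp (continuous_rot i j)) continuous_const
  have : θ ∈ closure (S : Set ℝ) := hdense θ
  rwa [hcl.closure_eq] at this

lemma exists_combination_rot_fixed (hπ : ∀ v, Continuous fun g => π g v) {i j : ι}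
    (hW : Module.finrank ℝ (weightSpace π i j) ≤ 1) {x y : V} (hx : x ∈ signFixed π)
    (hy : y ∈ signFixed π) :
    ∃ a b : ℝ, a ^ 2 + b ^ 2 = 1 ∧ ∀ θ, π (rot i j θ) (a • x + b • y) = a • x + b • y := by
  let C : ℕ → Set (ℝ × ℝ) := fun k => {c | c.1 ^ 2 + c.2 ^ 2 = 1 ∧
    π (rot i j (2 * Real.pi / 2 ^ k)) (c.1 • x + c.2 • y) = c.1 • x + c.2 • y}
  have hclosed : ∀ k, IsClosed (C k) := fun k => by
    refine IsClosed.inter (isClosed_eq (by fun_prop) continuous_const) (isClosed_eq ?_ ?_)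
    · exact (LinearMap.continuous_of_finiteDimensional _).comp (by fun_prop)
    · fun_prop
  have hbdd : C 0 ⊆ Set.Icc (-1) 1 ×ˢ Set.Icc (-1) 1 := by
    rintro ⟨a, b⟩ ⟨h, -⟩
    simp only [Set.mem_prod, Set.mem_Icc] at *
    refine ⟨⟨?_, ?_⟩, ?_, ?_⟩ <;> nlinarith
  obtain ⟨⟨a, b⟩, hab⟩ := IsCompact.nonempty_iInter_of_sequence_nonempty_isCompact_isClosed C
    (by
      rintro k ⟨a, b⟩ ⟨h1, h2⟩
      refine ⟨h1, ?_⟩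
      have : 2 * Real.pi / 2 ^ k = 2 * Real.pi / 2 ^ (k + 1) + 2 * Real.pi / 2 ^ (k + 1) := by
        rw [pow_succ]; field_simp; ring
      rw [this, ← rep_rot_rot, h2, h2])
    (by
      intro k
      obtain ⟨a, b, hab, h⟩ := exists_smul_add_smul_eq_zero hW
        (rot_sub_mem_weightSpace hx i j (Real.pi / 2 ^ k))
        (rot_sub_mem_weightSpace hy i j (Real.pi / 2 ^ k))
      refine ⟨(a, b), hab, ?_⟩
      have h1 : π (rot i j (Real.pi / 2 ^ k)) (a • x + b • y)
          = π (rot i j (-(Real.pi / 2 ^ k))) (a • x + b • y) := by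
        rw [← sub_eq_zero, ← h]
        simp only [map_add, map_smul]
        module
      change π (rot i j (2 * Real.pi / 2 ^ k)) (a • x + b • y) = a • x + b • y
      rw [show 2 * Real.pi / 2 ^ k = Real.pi / 2 ^ k + Real.pi / 2 ^ k by ring, ← rep_rot_rot, h1,
        rep_rot_rot, add_neg_cancel, rot_zero, map_one, Module.End.one_apply])
    (IsCompact.of_isClosed_subset (isCompact_Icc.prod isCompact_Icc) (hclosed 0) hbdd) hclosed
  rw [Set.mem_iInter] at hab
  exact ⟨a, b, (hab 0).1, rot_fixed_of_dyadic hπ fun k => (hab k).2⟩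

end Dimension

section Axial

variable {ι : Type*} [Fintype ι] [DecidableEq ι]
  {V : Type*} [NormedAddCommGroup V] [NormedSpace ℝ V] [FiniteDimensional ℝ V]
  {π : Representation ℝ (SO ι) V}

lemma exists_eq_smul_of_anti (hπ : ∀ v, Continuous fun g => π g v) {i j : ι}
    (hW : Module.finrank ℝ (weightSpace π i j) ≤ 1) {x y : V} (hx : x ∈ signFixed π)
    (hy : y ∈ signFixed π) (hx0 : x ≠ 0) (hsx : swapOp π i j x = -x) (hsy : swapOp π i j y = -y) :
    ∃ c : ℝ, y = c • x := by
  obtain ⟨a, b, hab, h⟩ := exists_combination_rot_fixed hπ hW hx hy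
  have h1 : swapOp π i j (a • x + b • y) = a • x + b • y := h _
  rw [map_add, map_smul, map_smul, hsx, hsy] at h1
  have h2 : a • x + b • y = 0 := by
    have h3 : (2 : ℝ) • (a • x + b • y) = 0 := by
      linear_combination (norm := module) -h1
    exact (smul_eq_zero.1 h3).resolve_left two_ne_zero
  have hb : b ≠ 0 := by
    rintro rfl
    rw [zero_smul, add_zero] at h2
    rcases smul_eq_zero.1 h2 with h3 | h3
    · subst h3; norm_num at hab
    · exact hx0 h3
  refine ⟨-(b⁻¹ * a), ?_⟩
  have h4 : b⁻¹ • (a • x + b • y) = 0 := by rw [h2, smul_zero]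
  rw [smul_add, smul_smul, smul_smul, inv_mul_cancel₀ hb, one_smul] at h4
  rw [neg_smul]
  exact eq_neg_of_add_eq_zero_right h4

lemma exists_anti {p q : ι} (hpq : p ≠ q) {v : V} (hv : v ∈ signFixed π)
    (hne : swapOp π p q v ≠ v) {i j : ι} (hij : i ≠ j) :
    ∃ y ∈ signFixed π, y ≠ 0 ∧ swapOp π i j y = -y := by
  refine pair_transitive (P := fun i j => ∃ y ∈ signFixed π, y ≠ 0 ∧ swapOp π i j y = -y)
    ?_ ?_ hpq ?_ hij
  · rintro i j ⟨y, hy, hy0, h⟩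
    exact ⟨y, hy, hy0, by rw [swapOp_comm hy, h]⟩
  · rintro i j k hij hik hjk ⟨y, hy, hy0, h⟩
    refine ⟨swapOp π j k y, swapOp_mem hy _ _, ?_, ?_⟩
    · intro h0
      exact hy0 (rep_injective π _ (h0.trans (map_zero _).symm))
    · rw [← swapOp_braid hij hik hjk, h, map_neg]
  · refine ⟨v - swapOp π p q v, Submodule.sub_mem _ hv (swapOp_mem hv _ _),
      sub_ne_zero.2 hne.symm, ?_⟩
    rw [map_sub, swapOp_swapOp hv, neg_sub]

lemma rot_fixed_of_swapOp_fixed (hπ : ∀ v, Continuous fun g => π g v) {i j : ι}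
    (hW : Module.finrank ℝ (weightSpace π i j) ≤ 1)
    (hanti : ∃ y ∈ signFixed π, y ≠ 0 ∧ swapOp π i j y = -y) {x : V} (hx : x ∈ signFixed π)
    (hsx : swapOp π i j x = x) (θ : ℝ) : π (rot i j θ) x = x := by
  obtain ⟨y, hy, hy0, hsy⟩ := hanti
  obtain ⟨a, b, hab, h⟩ := exists_combination_rot_fixed hπ hW hx hy
  have h1 : swapOp π i j (a • x + b • y) = a • x + b • y := h _
  rw [map_add, map_smul, map_smul, hsx, hsy] at h1
  have h3 : (2 * b) • y = 0 := by
    linear_combination (norm := module) -h1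
  have hb : b = 0 := by simpa [hy0] using h3
  subst hb
  have ha : a ≠ 0 := by rintro rfl; norm_num at hab
  have h4 := h θ
  rw [zero_smul, add_zero, map_smul] at h4
  exact smul_right_injective V ha h4

lemma exists_axial (hπ : ∀ v, Continuous fun g => π g v) (hcard : 5 ≤ Fintype.card ι)
    (hW : ∀ i j : ι, i ≠ j → Module.finrank ℝ (weightSpace π i j) ≤ 1) {p q : ι} (hpq : p ≠ q)
    {v : V} (hv : v ∈ signFixed π) (hne : swapOp π p q v ≠ v)
    (hswap : ∀ j k l, j ≠ k → j ≠ l → k ≠ l → swapOp π j k v = swapOp π j l v →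
      swapOp π j k v = v) :
    ∃ w ∈ signFixed π, (∀ j k, j ≠ p → k ≠ p → ∀ θ, π (rot j k θ) w = w) ∧
      swapOp π p q w ≠ w := by
  set α := v - swapOp π p q v with hα
  have hαm : α ∈ signFixed π := Submodule.sub_mem _ hv (swapOp_mem hv _ _)
  have hα0 : α ≠ 0 := sub_ne_zero.2 hne.symm
  have hsα : swapOp π p q α = -α := by rw [hα, map_sub, swapOp_swapOp hv, neg_sub]
  have hinj : ∀ {a b : ℝ}, a • α = b • α → a = b := fun h => smul_left_injective ℝ hα0 h
  have hcomm : ∀ j k, j ≠ p → j ≠ q → k ≠ p → k ≠ q → ∀ x, swapOp π j k (swapOp π p q x)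
      = swapOp π p q (swapOp π j k x) := fun j k h1 h2 h3 h4 x =>
    swapOp_rot_disjoint h1.symm h3.symm h2.symm h4.symm _ x
  -- a transposition disjoint from `{p, q}` acts on `α` by a sign
  have hscal : ∀ j k, j ≠ p → j ≠ q → k ≠ p → k ≠ q → ∃ c : ℝ, swapOp π j k α = c • α ∧
      (c = 1 ∨ c = -1) := by
    intro j k h1 h2 h3 h4
    obtain ⟨c, hc⟩ := exists_eq_smul_of_anti hπ (hW _ _ hpq) hαm (swapOp_mem hαm j k) hα0 hsα
      (by rw [← hcomm j k h1 h2 h3 h4, hsα, map_neg])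
    refine ⟨c, hc, ?_⟩
    have h5 := swapOp_swapOp hαm j k
    rw [hc, map_smul, hc, smul_smul] at h5
    have h6 : c * c = 1 := hinj (by rw [h5, one_smul])
    exact mul_self_eq_one_iff.1 h6
  have hfix : ∀ j k, j ≠ p → j ≠ q → k ≠ p → k ≠ q → j ≠ k → swapOp π j k α = α := by
    intro j k hjp hjq hkp hkq hjk
    obtain ⟨c, hc, h | h⟩ := hscal j k hjp hjq hkp hkq
    · rw [hc, h, one_smul]
    exfalso
    subst h
    obtain ⟨l, hl⟩ := exists_notMem_finset ({p, q, j, k} : Finset ι)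
      (lt_of_le_of_lt Finset.card_le_four (by omega))
    simp only [Finset.mem_insert, Finset.mem_singleton, not_or] at hl
    obtain ⟨hlp, hlq, hlj, hlk⟩ := hl
    have hb1 : ∀ x, swapOp π k l (swapOp π j k x) = swapOp π j l (swapOp π k l x) :=
      swapOp_braid hjk (Ne.symm hlj) (Ne.symm hlk)
    have hb2 : ∀ x ∈ signFixed π, swapOp π j l (swapOp π j k x)
        = swapOp π k l (swapOp π j l x) := fun x hx => by
      rw [← swapOp_comm hx, swapOp_braid hjk.symm (Ne.symm hlk) (Ne.symm hlj)]
    obtain ⟨c', hc', hc's⟩ := hscal j l hjp hjq hlp hlq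
    obtain ⟨c'', hc'', hc''s⟩ := hscal k l hkp hkq hlp hlq
    have e1 := hb1 α
    have e2 := hb2 α hαm
    rw [hc, hc'', map_smul, map_smul, hc', hc'', smul_smul, smul_smul] at e1
    rw [hc, hc', map_smul, map_smul, hc', hc'', smul_smul, smul_smul] at e2
    replace e1 := hinj e1
    replace e2 := hinj e2
    have hc'1 : c' = -1 := by
      rcases hc's with h | h
      · rcases hc''s with h' | h' <;> rw [h, h'] at e1 <;> norm_num at e1
      · exact h
    have hc''1 : c'' = -1 := by
      rw [hc'1] at e2
      linarith
    subst hc'1 hc''1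
    rw [neg_one_smul] at hc hc' hc''
    have hdiff : ∀ i m, i ≠ m → swapOp π i m α = -α → ∃ μ : ℝ, swapOp π i m v = v - μ • α := by
      intro i m him h
      obtain ⟨μ, hμ⟩ := exists_eq_smul_of_anti hπ (hW i m him) hαm
        (Submodule.sub_mem _ hv (swapOp_mem hv i m)) hα0 h
        (by rw [map_sub, swapOp_swapOp hv, neg_sub])
      exact ⟨μ, by rw [← hμ]; abel⟩
    obtain ⟨μ, hμ⟩ := hdiff j k hjk hc
    obtain ⟨μ', hμ'⟩ := hdiff j l (Ne.symm hlj) hc'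
    obtain ⟨μ'', hμ''⟩ := hdiff k l (Ne.symm hlk) hc''
    have f1 := hb1 v
    have f2 := hb2 v hv
    rw [hμ, hμ'', map_sub, map_sub, map_smul, map_smul, hc', hc'', hμ', hμ''] at f1
    rw [hμ, hμ', map_sub, map_sub, map_smul, map_smul, hc', hc'', hμ', hμ''] at f2
    have g1 : μ + μ' = 2 * μ'' := hinj (by linear_combination (norm := module) f1)
    have g2 : μ + μ'' = 2 * μ' := hinj (by linear_combination (norm := module) f2)
    have g3 : μ = μ' := by linarith
    have h7 := hswap j k l hjk (Ne.symm hlj) (Ne.symm hlk) (by rw [hμ, hμ', g3])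
    have h8 : swapOp π j k α = α := by
      rw [hα, map_sub, hcomm j k hjp hjq hkp hkq, h7]
    rw [hc] at h8
    have h9 : (-1 : ℝ) = 1 := hinj (by rw [neg_one_smul, one_smul, h8])
    norm_num at h9
  set a : ι → V := fun l => swapOp π q l α with ha
  have haq : a q = α := swapOp_self q α
  have ham : ∀ l, a l ∈ signFixed π := fun l => swapOp_mem hαm _ _
  have hafix : ∀ j k l, j ≠ p → k ≠ p → l ≠ p → j ≠ k → l ≠ j → l ≠ k →
      swapOp π j k (a l) = a l := by
    have key : ∀ k l, k ≠ p → l ≠ p → q ≠ k → l ≠ q → l ≠ k →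
        swapOp π q k (a l) = a l := by
      intro k l hk hl hqk hlq hlk
      have h := swapOp_braid (π := π) (Ne.symm hlk) (Ne.symm hqk) hlq α
      rw [hfix k l hk hqk.symm hl hlq (Ne.symm hlk), swapOp_comm hαm, swapOp_comm (ham l)] at h
      exact h.symm
    intro j k l hj hk hl hjk hlj hlk
    by_cases hlq : l = q
    · subst hlq
      rw [haq, hfix j k hj (Ne.symm hlj) hk (Ne.symm hlk) hjk]
    by_cases hjq : j = q
    · subst hjq; exact key k l hk hl hjk hlq hlk
    by_cases hkq : k = q
    · subst hkq; rw [swapOp_comm (ham l)]; exact key j l hj hl hjk.symm hlq hlj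
    rw [ha]
    change swapOp π j k (π (rot q l _) α) = _
    rw [swapOp_rot_disjoint (Ne.symm hjq) (Ne.symm hkq) hlj hlk, hfix j k hj hjq hk hkq hjk]
    rfl
  have hamove : ∀ k l, k ≠ p → l ≠ p → l ≠ k → swapOp π l k (a l) = a k := by
    intro k l hk hl hlk
    by_cases hlq : l = q
    · subst hlq; rw [haq]
    by_cases hkq : k = q
    · subst hkq
      rw [haq, ha, swapOp_comm (swapOp_mem hαm _ _), swapOp_swapOp hαm]
    have h := swapOp_braid (π := π) (Ne.symm hlq) (Ne.symm hkq) hlk α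
    rw [hfix l k hl hlq hk hkq hlk] at h
    exact h
  set w := ∑ l ∈ Finset.univ.erase p, a l with hw
  have hwm : w ∈ signFixed π := Submodule.sum_mem _ fun l _ => ham l
  refine ⟨w, hwm, ?_, ?_⟩
  · intro j k hj hk θ
    by_cases hjk : j = k
    · subst hjk; simp [rot_self]
    refine rot_fixed_of_swapOp_fixed hπ (hW j k hjk) (exists_anti hpq hv hne hjk) hwm ?_ θ
    rw [hw, map_sum]
    refine Finset.sum_equiv (Equiv.swap j k) ?_ ?_
    · intro l
      simp only [Finset.mem_erase, Finset.mem_univ, and_true, ne_eq]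
      rw [Equiv.swap_apply_eq_iff, Equiv.swap_apply_of_ne_of_ne (Ne.symm hj) (Ne.symm hk)]
    · intro l hl
      have hlp : l ≠ p := (Finset.mem_erase.1 hl).1
      by_cases hlj : l = j
      · subst hlj; rw [Equiv.swap_apply_left, hamove k l hk hlp hjk]
      by_cases hlk : l = k
      · subst hlk; rw [Equiv.swap_apply_right, swapOp_comm (ham l), hamove j l hj hlp hlj]
      rw [Equiv.swap_apply_of_ne_of_ne hlj hlk, hafix j k l hj hk hlp hjk hlj hlk]
  · obtain ⟨l, hl⟩ := exists_notMem_finset ({p, q} : Finset ι)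
      (lt_of_le_of_lt Finset.card_le_two (by omega))
    simp only [Finset.mem_insert, Finset.mem_singleton, not_or] at hl
    obtain ⟨hlp, hlq⟩ := hl
    obtain ⟨c, hc⟩ := exists_eq_smul_of_anti hπ (hW _ _ hpq) hαm
      (Submodule.sub_mem _ (ham l) (swapOp_mem (ham l) p q)) hα0 hsα
      (by rw [map_sub, swapOp_swapOp (ham l), neg_sub])
    have hcl : swapOp π p q (a l) = a l - c • α := by rw [← hc]; abel
    have hck : ∀ k, k ≠ p → k ≠ q → swapOp π p q (a k) = a k - c • α := by
      intro k hkp hkq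
      by_cases hkl : l = k
      · exact hkl ▸ hcl
      have h := congrArg (swapOp π l k) hcl
      rwa [hcomm l k hlp hlq hkp hkq, map_sub, map_smul, hamove k l hkp hlp hkl,
        hfix l k hlp hlq hkp hkq hkl] at h
    have hsum : swapOp π p q w = w - (2 + (Fintype.card ι - 2 : ℝ) * c) • α := by
      have hqm : q ∈ Finset.univ.erase p := Finset.mem_erase.2 ⟨hpq.symm, Finset.mem_univ _⟩
      have hcard2 : (((Finset.univ.erase p).erase q).card : ℝ) = Fintype.card ι - 2 := by
        rw [Finset.card_erase_of_mem hqm, Finset.card_erase_of_mem (Finset.mem_univ _),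
          Finset.card_univ, Nat.sub_sub, Nat.cast_sub (by omega)]
        norm_num
      rw [hw, ← Finset.add_sum_erase _ _ hqm, map_add, map_sum, haq, hsα,
        Finset.sum_congr rfl (g := fun k => a k - c • α) fun k hk => ?_,
        Finset.sum_sub_distrib, Finset.sum_const, ← Nat.cast_smul_eq_nsmul ℝ, hcard2]
      · module
      · rw [Finset.mem_erase, Finset.mem_erase] at hk
        exact hck k hk.2.1 hk.1
    rw [hsum]
    intro h
    have h0 : (2 + (Fintype.card ι - 2 : ℝ) * c) • α = 0 := by
      rw [sub_eq_self] at h; exact h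
    have h1 : 2 + (Fintype.card ι - 2 : ℝ) * c = 0 := (smul_eq_zero.1 h0).resolve_right hα0
    have hn : (5 : ℝ) ≤ Fintype.card ι := by exact_mod_cast hcard
    have hbr : (1 - c) • (α + a l) = 0 := by
      have h4 : swapOp π q l (swapOp π p q (a l)) = swapOp π p l (swapOp π q l (a l)) :=
        swapOp_braid hpq (Ne.symm hlp) (Ne.symm hlq) _
      have h5 : swapOp π p q (swapOp π q l (swapOp π p q α))
          = swapOp π p l α := by
        have h6 := swapOp_braid (π := π) hlq hlp (Ne.symm hpq) (swapOp π p q α)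
        rw [swapOp_comm (swapOp_mem (swapOp_mem hαm _ _) _ _),
          swapOp_comm (swapOp_mem hαm _ _)] at h6
        rw [h6, swapOp_comm (swapOp_mem hαm p q) p q, swapOp_swapOp hαm, swapOp_comm hαm]
      rw [hsα, map_neg, map_neg] at h5
      have h7 : swapOp π q l (a l) = α := swapOp_swapOp hαm q l
      rw [hcl, map_sub, map_smul, h7, ← h5] at h4
      change α - c • a l = -swapOp π p q (a l) at h4
      rw [hcl] at h4
      linear_combination (norm := module) h4
    rcases smul_eq_zero.1 hbr with h2 | h2
    · have : c = 1 := by linarith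
      subst this
      linarith
    · have h3 : a l = -α := eq_neg_of_add_eq_zero_right h2
      rw [h3, map_neg, hsα] at hcl
      have h4 : c = -2 := hinj (by linear_combination (norm := module) hcl)
      subst h4
      linarith

end Axial

section DAlembert

/-- A continuous solution of the cosine functional equation with prescribed first zero is a cosine. -/
lemma eq_cos_of_dAlembert {c : ℝ → ℝ} (hc : Continuous c) (h0 : c 0 = 1)
    (h1 : c (Real.pi / 2) = -1) (hadd : ∀ θ φ, c (θ + φ) + c (θ - φ) = 2 * c θ * c φ)
    (hne : ∀ θ, 0 < θ → θ < Real.pi / 4 → c θ ≠ 0) (θ : ℝ) : c θ = Real.cos (2 * θ) := by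
  have hpi := Real.pi_pos
  have heven : ∀ φ, c (-φ) = c φ := fun φ => by
    have := hadd 0 φ
    rw [zero_add, zero_sub, h0] at this
    linarith
  have hdouble : ∀ φ, c (2 * φ) = 2 * c φ ^ 2 - 1 := fun φ => by
    have := hadd φ φ
    rw [sub_self, h0, ← two_mul] at this
    linarith
  have hpos : ∀ φ, 0 < φ → φ < Real.pi / 4 → 0 < c φ := by
    intro φ hφ0 hφ
    by_contra! hneg
    obtain ⟨x, hx, hx0⟩ := intermediate_value_Icc' hφ0.le hc.continuousOn
      (show (0 : ℝ) ∈ Set.Icc (c φ) (c 0) from ⟨hneg, by rw [h0]; exact zero_le_one⟩)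
    have hx1 : x ≠ 0 := by rintro rfl; rw [h0] at hx0; norm_num at hx0
    exact hne x (lt_of_le_of_ne hx.1 hx1.symm) (hx.2.trans_lt hφ) hx0
  have hdy : ∀ k : ℕ, c (Real.pi / 4 / 2 ^ k) = Real.cos (2 * (Real.pi / 4 / 2 ^ k)) := by
    intro k
    induction k with
    | zero =>
      have h2 := hdouble (Real.pi / 4)
      rw [show 2 * (Real.pi / 4) = Real.pi / 2 by ring, h1] at h2
      have h3 : c (Real.pi / 4) = 0 := by nlinarith
      rw [pow_zero, div_one, h3, show 2 * (Real.pi / 4) = Real.pi / 2 by ring, Real.cos_pi_div_two]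
    | succ k ih =>
      set x := Real.pi / 4 / 2 ^ (k + 1) with hx
      have hx2 : Real.pi / 4 / 2 ^ k = 2 * x := by rw [hx, pow_succ]; field_simp
      have hx0 : 0 < x := by positivity
      have hxlt : x < Real.pi / 4 := div_lt_self (by positivity) (one_lt_pow₀ one_lt_two (by omega))
      rw [hx2, hdouble, Real.cos_two_mul] at ih
      have hc1 := hpos x hx0 hxlt
      have hc2 : 0 < Real.cos (2 * x) := Real.cos_pos_of_mem_Ioo ⟨by linarith, by linarith⟩
      have : (c x - Real.cos (2 * x)) * (c x + Real.cos (2 * x)) = 0 := by linarith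
      rcases mul_eq_zero.1 this with h | h <;> linarith
  have hmul : ∀ k m : ℕ, c (m * (Real.pi / 4 / 2 ^ k))
      = Real.cos (2 * (m * (Real.pi / 4 / 2 ^ k))) := by
    intro k
    set x := Real.pi / 4 / 2 ^ k
    suffices h : ∀ m : ℕ, c (m * x) = Real.cos (2 * (m * x)) ∧
        c ((m + 1 : ℕ) * x) = Real.cos (2 * ((m + 1 : ℕ) * x)) from fun m => (h m).1
    intro m
    induction m with
    | zero => simpa [h0] using hdy k
    | succ m ih =>
      refine ⟨ih.2, ?_⟩
      have h2 := hadd ((m + 1 : ℕ) * x) x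
      have h3 := Real.cos_add (2 * ((m + 1 : ℕ) * x)) (2 * x)
      have h4 := Real.cos_sub (2 * ((m + 1 : ℕ) * x)) (2 * x)
      rw [ih.2, hdy k] at h2
      push_cast at *
      rw [show ((m : ℝ) + 1) * x + x = (m + 1 + 1) * x by ring,
        show ((m : ℝ) + 1) * x - x = m * x by ring, ih.1] at h2
      rw [show 2 * (((m : ℝ) + 1) * x) + 2 * x = 2 * ((m + 1 + 1) * x) by ring] at h3
      rw [show 2 * (((m : ℝ) + 1) * x) - 2 * x = 2 * (m * x) by ring] at h4
      linarith
  have hmultiple : ∀ (k : ℕ) (m : ℤ), c (m * (Real.pi / 4 / 2 ^ k))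
      = Real.cos (2 * (m * (Real.pi / 4 / 2 ^ k))) := by
    intro k m
    obtain ⟨m, rfl | rfl⟩ := m.eq_nat_or_neg
    · exact_mod_cast hmul k m
    · push_cast
      rw [neg_mul, heven, hmul, mul_neg, Real.cos_neg]
  have hclosed : IsClosed {x | c x = Real.cos (2 * x)} := isClosed_eq hc (by fun_prop)
  have hmem : θ ∈ closure {x | c x = Real.cos (2 * x)} := by
    rw [Metric.mem_closure_iff]
    intro ε hε
    obtain ⟨k, hk⟩ := pow_unbounded_of_one_lt (Real.pi / 4 / ε) one_lt_two
    have hx : Real.pi / 4 / 2 ^ k < ε := by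
      rw [div_lt_iff₀ (by positivity)]
      rw [div_lt_iff₀ hε] at hk
      linarith
    have hx0 : 0 < Real.pi / 4 / 2 ^ k := by positivity
    refine ⟨_, hmultiple k ⌊θ / (Real.pi / 4 / 2 ^ k)⌋, ?_⟩
    rw [Real.dist_eq, abs_of_nonneg (Int.sub_floor_div_mul_nonneg θ hx0)]
    exact (Int.sub_floor_div_mul_lt θ hx0).trans hx
  rwa [hclosed.closure_eq] at hmem

end DAlembert

section AxialRotation

variable {ι : Type*} [Fintype ι] [DecidableEq ι]
  {V : Type*} [NormedAddCommGroup V] [NormedSpace ℝ V] [FiniteDimensional ℝ V]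
  {π : Representation ℝ (SO ι) V}

variable (π) in
/-- The subgroup fixing a vector of a representation. -/
def repStab (w : V) : Subgroup (SO ι) where
  carrier := {g | π g w = w}
  mul_mem' {g h} hg hh := by
    simp only [Set.mem_ofPred_eq] at *
    rw [map_mul, Module.End.mul_apply, hh, hg]
  one_mem' := by simp
  inv_mem' {g} hg := by
    simp only [Set.mem_ofPred_eq] at *
    conv_lhs => rw [← hg]
    exact rep_inv_apply π g w

lemma mem_repStab {w : V} {g : SO ι} : g ∈ repStab π w ↔ π g w = w := Iff.rfl

lemma vecStab_le_repStab {p : ι} {w : V}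
    (hst : ∀ j k, j ≠ p → k ≠ p → ∀ θ, π (rot j k θ) w = w) :
    vecStab (e p) ≤ repStab π w := fun g hg =>
  mem_of_mulVec_e_eq (repStab π w) p (fun j k hj hk θ => hst j k hj hk θ) g hg

lemma axial_rot_ne {p q : ι} (hpq : p ≠ q) (hcard : 5 ≤ Fintype.card ι) {w : V}
    (hst : ∀ j k, j ≠ p → k ≠ p → ∀ θ, π (rot j k θ) w = w) (hne : swapOp π p q w ≠ w) {ψ : ℝ}
    (hψ0 : 0 < ψ) (hψ : ψ < Real.pi) : π (rot p q ψ) w ≠ w := by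
  intro hfix
  have hpi := Real.pi_pos
  have hsin : 0 < Real.sin ψ := Real.sin_pos_of_pos_of_lt_pi hψ0 hψ
  obtain ⟨r, hr⟩ := exists_notMem_finset ({p, q} : Finset ι)
    (lt_of_le_of_lt Finset.card_le_two (by omega))
  simp only [Finset.mem_insert, Finset.mem_singleton, not_or] at hr
  obtain ⟨hrp, hrq⟩ := hr
  have hsmall : ∀ δ : ℝ, 0 ≤ Real.sin δ → Real.cos (2 * ψ) ≤ Real.cos δ →
      rot p q δ ∈ repStab π w := by
    intro δ hδ hcos
    set t := (Real.cos δ - Real.cos ψ ^ 2) / Real.sin ψ ^ 2 with ht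
    have hsc := Real.sin_sq_add_cos_sq ψ
    have ht1 : -1 ≤ t := by
      rw [ht, le_div_iff₀ (by positivity)]
      rw [Real.cos_two_mul] at hcos
      linarith
    have ht2 : t ≤ 1 := by
      rw [ht, div_le_iff₀ (by positivity)]
      linarith [Real.cos_le_one δ]
    have hχ : Real.cos (Real.arccos t) = t := Real.cos_arccos ht1 ht2
    set g := rot p q (-ψ) * rot q r (Real.arccos t) * rot p q ψ with hg
    have hgw : g ∈ repStab π w := by
      refine mul_mem (mul_mem ?_ (hst q r hpq.symm hrp _)) hfix
      rw [rot_neg]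
      exact inv_mem (show rot p q ψ ∈ repStab π w from hfix)
    have hgp : (g.1 *ᵥ e p) p = Real.cos δ := by
      have : g.1 = (rot p q (-ψ)).1 * (rot q r (Real.arccos t)).1 * (rot p q ψ).1 := rfl
      rw [this, ← mulVec_mulVec, ← mulVec_mulVec, rot_mulVec_left hpq, mulVec_add, mulVec_smul,
        mulVec_smul, rot_mulVec_left (Ne.symm hrq), rot_mulVec_of_ne hpq (Ne.symm hrp)]
      simp only [mulVec_add, mulVec_smul]
      rw [rot_mulVec_left hpq, rot_mulVec_right hpq, rot_mulVec_of_ne hrp hrq]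
      have htm : t * Real.sin ψ ^ 2 = Real.cos δ - Real.cos ψ ^ 2 :=
        div_mul_cancel₀ _ (by positivity)
      simp [hpq, Ne.symm hrp, hχ]
      linarith
    obtain ⟨h, hh, s, hs, hhs⟩ := exists_vecStab_mulVec_eq hpq (by omega) (g.1 *ᵥ e p)
    rw [hgp] at hhs
    have hs2 : Real.cos δ ^ 2 + s ^ 2 = 1 := by
      have h1 := SO_dot h (g.1 *ᵥ e p) (g.1 *ᵥ e p)
      rw [hhs, SO_dot, e_dot_self] at h1
      simp only [add_dotProduct, dotProduct_add, smul_dotProduct, dotProduct_smul, e_dot_self,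
        e_dot hpq, e_dot hpq.symm, smul_eq_mul] at h1
      linarith
    have hs3 : s = Real.sin δ := by
      have h1 : (s - Real.sin δ) * (s + Real.sin δ) = 0 := by
        linarith [Real.sin_sq_add_cos_sq δ]
      rcases mul_eq_zero.1 h1 with h | h <;> linarith
    rw [hs3, ← rot_mulVec_left hpq] at hhs
    have hmem : (rot p q δ)⁻¹ * (h * g) ∈ vecStab (e p) := by
      rw [mem_vecStab, Submonoid.coe_mul, Submonoid.coe_mul, ← mulVec_mulVec, ← mulVec_mulVec, hhs,
        mulVec_mulVec, SO_coe_inv, SO_transpose_mul, one_mulVec]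
    have h2 := vecStab_le_repStab hst hmem
    have h3 := mul_mem (mul_mem (vecStab_le_repStab hst hh) hgw) (inv_mem h2)
    rwa [_root_.mul_inv_rev, inv_inv, mul_inv_cancel_left] at h3
  have hlim : Filter.Tendsto (fun m : ℕ => Real.cos (Real.pi / 2 / m)) Filter.atTop (𝓝 1) := by
    have := (Real.continuous_cos.tendsto 0).comp
      (tendsto_const_div_atTop_nhds_zero_nat (Real.pi / 2))
    rwa [Real.cos_zero] at this
  have hlt : Real.cos (2 * ψ) < 1 := by
    rw [Real.cos_two_mul]
    nlinarith [Real.sin_sq_add_cos_sq ψ]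
  obtain ⟨m, hm, hm1⟩ := ((hlim.eventually (eventually_ge_nhds hlt)).and
    (Filter.eventually_ge_atTop 1)).exists
  have hm1' : (1 : ℝ) ≤ m := by exact_mod_cast hm1
  have hδ := hsmall (Real.pi / 2 / m) (Real.sin_nonneg_of_nonneg_of_le_pi (by positivity)
    ((div_le_self (by positivity) hm1').trans (by linarith))) hm
  have hmul : ∀ k : ℕ, rot p q (k * (Real.pi / 2 / m)) ∈ repStab π w := by
    intro k
    induction k with
    | zero => rw [Nat.cast_zero, zero_mul, rot_zero]; exact one_mem _
    | succ k ih =>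
      rw [Nat.cast_succ, add_mul, one_mul, rot_add]
      exact mul_mem ih hδ
  have := hmul m
  rw [mul_div_cancel₀ _ (by positivity)] at this
  exact hne this

lemma exists_rot_formula (hπ : ∀ v, Continuous fun g => π g v) (hcard : 5 ≤ Fintype.card ι)
    {p q : ι} (hpq : p ≠ q) (hW : Module.finrank ℝ (weightSpace π p q) ≤ 1) {w : V}
    (hw : w ∈ signFixed π) (hst : ∀ j k, j ≠ p → k ≠ p → ∀ θ, π (rot j k θ) w = w)
    (hne : swapOp π p q w ≠ w) :
    ∃ z : V, ∀ θ, π (rot p q θ) w = Real.cos θ ^ 2 • w + Real.sin θ ^ 2 • swapOp π p q w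
      + (Real.sin θ * Real.cos θ) • z := by
  set d := w - swapOp π p q w with hd
  have hdm : d ∈ signFixed π := Submodule.sub_mem _ hw (swapOp_mem hw _ _)
  have hd0 : d ≠ 0 := sub_ne_zero.2 hne.symm
  have hsd : swapOp π p q d = -d := by rw [hd, map_sub, swapOp_swapOp hw, neg_sub]
  have hm : ∀ θ, π (rot p q θ) (w + swapOp π p q w) = w + swapOp π p q w :=
    rot_fixed_of_swapOp_fixed hπ hW ⟨d, hdm, hd0, hsd⟩
      (Submodule.add_mem _ hw (swapOp_mem hw _ _)) (by rw [map_add, swapOp_swapOp hw, add_comm])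
  have hwd : w = (1 / 2 : ℝ) • (w + swapOp π p q w) + (1 / 2 : ℝ) • d := by rw [hd]; module
  obtain ⟨f, hf⟩ := SeparatingDual.exists_eq_one (R := ℝ) hd0
  set c : ℝ → ℝ := fun θ => f (π (rot p q θ) d + π (rot p q (-θ)) d) / 2 with hc
  have hcd : ∀ θ, π (rot p q θ) d + π (rot p q (-θ)) d = (2 * c θ) • d := by
    intro θ
    have hcom : ∀ φ, swapOp π p q (π (rot p q φ) d) = -π (rot p q φ) d := fun φ => by
      rw [swapOp, rep_rot_rot, add_comm, ← rep_rot_rot]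
      change π (rot p q φ) (swapOp π p q d) = _
      rw [hsd, map_neg]
    obtain ⟨a, ha⟩ := exists_eq_smul_of_anti hπ hW hdm (rot_add_mem_signFixed hdm p q θ) hd0 hsd
      (by rw [map_add, hcom, hcom]; abel)
    rw [hc]
    simp only
    rw [ha, map_smul, hf, smul_eq_mul, mul_one, mul_div_cancel₀ _ two_ne_zero]
  have hinj : ∀ {a b : ℝ}, a • d = b • d → a = b := fun h => smul_left_injective ℝ hd0 h
  have hcont : Continuous c := by
    have h1 : Continuous fun θ => π (rot p q θ) d := (hπ d).comp (continuous_rot p q)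
    have h2 : Continuous fun θ => π (rot p q (-θ)) d := h1.comp continuous_neg
    exact (f.continuous.comp (h1.add h2)).div_const 2
  have hc0 : c 0 = 1 := by
    have h := hcd 0
    rw [neg_zero, rot_zero, map_one, Module.End.one_apply] at h
    have : (2 : ℝ) = 2 * c 0 := hinj (by rw [← h, two_smul])
    linarith
  have hc1 : c (Real.pi / 2) = -1 := by
    have h := hcd (Real.pi / 2)
    rw [rot_neg_half_pi hdm] at h
    change swapOp π p q d + _ = _ at h
    rw [hsd] at h
    have : (-2 : ℝ) = 2 * c (Real.pi / 2) := hinj (by rw [← h]; module)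
    linarith
  have hadd : ∀ θ φ, c (θ + φ) + c (θ - φ) = 2 * c θ * c φ := by
    intro θ φ
    have h1 := congrArg (π (rot p q φ)) (hcd θ)
    have h2 := congrArg (π (rot p q (-φ))) (hcd θ)
    rw [map_add, rep_rot_rot, rep_rot_rot, map_smul] at h1 h2
    have h3 := hcd (θ + φ)
    have h4 := hcd (θ - φ)
    have h5 := hcd φ
    rw [show φ + θ = θ + φ by ring, show φ + -θ = -(θ - φ) by ring] at h1
    rw [show -φ + θ = θ - φ by ring, show -φ + -θ = -(θ + φ) by ring] at h2
    have h6 : 2 * c (θ + φ) + 2 * c (θ - φ) = 2 * c θ * (2 * c φ) := hinj (by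
      rw [add_smul, ← h3, ← h4, mul_smul, ← h5, smul_add, ← h1, ← h2]
      abel)
    linarith
  have hcos := eq_cos_of_dAlembert hcont hc0 hc1 hadd (by
    intro θ hθ0 hθ hcθ
    have h1 := hcd θ
    rw [hcθ, mul_zero, zero_smul] at h1
    have h2 := congrArg (π (rot p q θ)) h1
    rw [map_add, rep_rot_rot, rep_rot_rot, add_neg_cancel, rot_zero, map_one, Module.End.one_apply,
      map_zero] at h2
    have h3 : π (rot p q (θ + θ)) d = -d := eq_neg_of_add_eq_zero_left h2
    have h4 : π (rot p q (θ + θ + (θ + θ))) d = d := by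
      rw [← rep_rot_rot, h3, map_neg, h3, neg_neg]
    refine axial_rot_ne hpq hcard hst hne (ψ := θ + θ + (θ + θ)) (by linarith) (by linarith) ?_
    conv_lhs => rw [hwd]
    rw [map_add, map_smul, map_smul, hm, h4, ← hwd])
  refine ⟨π (rot p q (Real.pi / 4)) d, fun θ => ?_⟩
  have hcθ := hcd θ
  have hcθ' := congrArg (π (rot p q (Real.pi / 4))) (hcd (θ - Real.pi / 4))
  rw [map_add, rep_rot_rot, rep_rot_rot, map_smul, hcos] at hcθ'
  rw [hcos] at hcθ
  have h1 : π (rot p q (Real.pi / 4 + -(θ - Real.pi / 4))) d = -π (rot p q (-θ)) d := by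
    rw [show Real.pi / 4 + -(θ - Real.pi / 4) = -θ + Real.pi / 2 by ring, ← rep_rot_rot]
    change π (rot p q (-θ)) (swapOp π p q d) = _
    rw [hsd, map_neg]
  rw [h1, show Real.pi / 4 + (θ - Real.pi / 4) = θ by ring,
    show 2 * (θ - Real.pi / 4) = 2 * θ - Real.pi / 2 by ring, Real.cos_sub_pi_div_two] at hcθ'
  have h2 : π (rot p q θ) d = Real.cos (2 * θ) • d
      + Real.sin (2 * θ) • π (rot p q (Real.pi / 4)) d := by
    linear_combination (norm := module) (1 / 2 : ℝ) • hcθ + (1 / 2 : ℝ) • hcθ'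
  conv_lhs => rw [hwd]
  rw [map_add, map_smul, map_smul, hm, h2, Real.cos_two_mul, Real.sin_two_mul, Real.sin_sq]
  generalize π (rot p q (Real.pi / 4)) d = z
  rw [hd]
  module

end AxialRotation

section Bilinear

/-- A function satisfying the parallelogram law whose polar form is homogeneous comes from a
bilinear map. -/
lemma exists_bilinear_of_plane {E V : Type*} [AddCommGroup E] [Module ℝ E] [AddCommGroup V]
    [Module ℝ V] (F : E → V)
    (hF : ∀ (x y : E) (s t : ℝ), F (s • x + t • y)
      = s ^ 2 • F x + t ^ 2 • F y + (s * t) • (F (x + y) - F x - F y)) :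
    ∃ B : E →ₗ[ℝ] E →ₗ[ℝ] V, ∀ x y, B x y = F (x + y) - F x - F y := by
  have hsmul : ∀ (s : ℝ) x, F (s • x) = s ^ 2 • F x := fun s x => by
    simpa using hF x x s 0
  have hpar : ∀ x y, F (x + y) + F (x - y) = (2 : ℝ) • F x + (2 : ℝ) • F y := fun x y => by
    have h := hF x y 1 (-1)
    rw [one_smul, neg_one_smul, ← sub_eq_add_neg] at h
    rw [h]
    module
  have hcube : ∀ x y z, F (x + y + z)
      = F (x + y) + F (y + z) + F (x + z) - F x - F y - F z := fun x y z => by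
    have h1 := hpar (x + z) y
    have h2 := hpar (y + z) x
    have h3 := hpar z (x - y)
    have h4 := hpar x y
    rw [show x + z + y = x + y + z by abel] at h1
    rw [show y + z + x = x + y + z by abel] at h2
    rw [show z + (x - y) = x + z - y by abel, show z - (x - y) = y + z - x by abel] at h3
    linear_combination (norm := module)
      (1 / 2 : ℝ) • h1 + (1 / 2 : ℝ) • h2 - (1 / 2 : ℝ) • h3 - h4
  have hcomm : ∀ x y, F (x + y) - F x - F y = F (y + x) - F y - F x := fun x y => by
    rw [add_comm]; abel
  have hadd : ∀ x y z, F (x + y + z) - F (x + y) - F z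
      = (F (x + z) - F x - F z) + (F (y + z) - F y - F z) := fun x y z => by
    rw [hcube]; abel
  have hhom : ∀ (c : ℝ) x y, F (c • x + y) - F (c • x) - F y = c • (F (x + y) - F x - F y) :=
    fun c x y => by
      have h := hF x y c 1
      rw [one_smul] at h
      rw [h, hsmul]
      module
  refine ⟨LinearMap.mk₂ ℝ (fun x y => F (x + y) - F x - F y) hadd hhom ?_ ?_, fun x y => rfl⟩
  · intro x y z
    rw [hcomm, hadd, hcomm y, hcomm z]
  · intro c x y
    rw [hcomm, hhom, hcomm y]

variable {ι : Type*} [Fintype ι] [DecidableEq ι]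
  {V : Type*} [NormedAddCommGroup V] [NormedSpace ℝ V] [FiniteDimensional ℝ V]
  {π : Representation ℝ (SO ι) V}

lemma axial_wellDefined {p q : ι} (hpq : p ≠ q) {w : V} (hw : w ∈ signFixed π)
    (hst : ∀ j k, j ≠ p → k ≠ p → ∀ θ, π (rot j k θ) w = w) {g h : SO ι} {r s : ℝ}
    (heq : g.1 *ᵥ (r • e p) = h.1 *ᵥ (s • e p)) : r ^ 2 • π g w = s ^ 2 • π h w := by
  have hrs : r ^ 2 = s ^ 2 := by
    have h1 := SO_dot g (r • e p) (r • e p)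
    rw [heq, SO_dot] at h1
    simp only [smul_dotProduct, dotProduct_smul, e_dot_self, smul_eq_mul] at h1
    linarith
  rw [hrs]
  by_cases hs : s = 0
  · simp [hs]
  congr 1
  have h2 : (h⁻¹ * g).1 *ᵥ (r • e p) = s • e p := by
    rw [Submonoid.coe_mul, ← mulVec_mulVec, heq, mulVec_mulVec, SO_coe_inv, SO_transpose_mul,
      one_mulVec]
  have h3 : π (h⁻¹ * g) w = w := by
    rw [mulVec_smul] at h2
    rcases sq_eq_sq_iff_eq_or_eq_neg.1 hrs with hr | hr
    · subst hr
      exact vecStab_le_repStab hst (smul_right_injective _ hs h2)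
    · have h4 : (h⁻¹ * g).1 *ᵥ e p = -e p := by
        apply smul_right_injective _ hs
        simp only
        rw [smul_neg, ← h2, hr, neg_smul, neg_neg]
      have h5 : h⁻¹ * g * rot p q Real.pi ∈ vecStab (e p) := by
        rw [mem_vecStab, Submonoid.coe_mul, ← mulVec_mulVec, rot_mulVec_left hpq]
        rw [Real.cos_pi, Real.sin_pi, zero_smul, add_zero, neg_one_smul, mulVec_neg, h4, neg_neg]
      have h6 := vecStab_le_repStab hst h5
      rw [mem_repStab, map_mul, Module.End.mul_apply, rot_pi_apply hw] at h6
      exact h6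
  have h7 := congrArg (π h) h3
  rwa [← Module.End.mul_apply, ← map_mul, mul_inv_cancel_left] at h7

lemma exists_equivariant_bilinear (hπ : ∀ v, Continuous fun g => π g v)
    (hcard : 5 ≤ Fintype.card ι) {p q : ι} (hpq : p ≠ q)
    (hW : Module.finrank ℝ (weightSpace π p q) ≤ 1) {w : V} (hw : w ∈ signFixed π)
    (hst : ∀ j k, j ≠ p → k ≠ p → ∀ θ, π (rot j k θ) w = w) (hne : swapOp π p q w ≠ w) :
    ∃ B : (ι → ℝ) →ₗ[ℝ] (ι → ℝ) →ₗ[ℝ] V,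
      (∀ (g : SO ι) x y, π g (B x y) = B (g.1 *ᵥ x) (g.1 *ᵥ y)) ∧ B (e p) (e p) = (2 : ℝ) • w := by
  obtain ⟨z, hz⟩ := exists_rot_formula hπ hcard hpq hW hw hst hne
  choose G R hGR using exists_smul_e_eq (ι := ι) p
  set F : (ι → ℝ) → V := fun x => R x ^ 2 • π (G x) w with hFdef
  have hF : ∀ (g : SO ι) (r : ℝ), F (g.1 *ᵥ (r • e p)) = r ^ 2 • π g w := fun g r =>
    axial_wellDefined hpq hw hst (hGR _)
  have hequiv : ∀ (g : SO ι) x, F (g.1 *ᵥ x) = π g (F x) := by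
    intro g x
    obtain ⟨h, r, rfl⟩ := exists_smul_e_eq p x
    rw [mulVec_mulVec, ← Submonoid.coe_mul, hF, hF, map_mul, Module.End.mul_apply, map_smul]
  have hplane : ∀ a b : ℝ, F (a • e p + b • e q)
      = a ^ 2 • w + b ^ 2 • swapOp π p q w + (a * b) • z := by
    intro a b
    have ha := Complex.norm_mul_cos_arg ⟨a, b⟩
    have hb := Complex.norm_mul_sin_arg ⟨a, b⟩
    set r := ‖(⟨a, b⟩ : ℂ)‖
    set θ := Complex.arg ⟨a, b⟩
    simp only at ha hb
    have h1 : a • e p + b • e q = (rot p q θ).1 *ᵥ (r • e p) := by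
      rw [mulVec_smul, rot_mulVec_left hpq, smul_add, smul_smul, smul_smul, ha, hb]
    rw [h1, hF, hz, ← ha, ← hb]
    module
  obtain ⟨B, hB⟩ := exists_bilinear_of_plane F (by
    intro x y s t
    obtain ⟨g, a, b, c, rfl, rfl⟩ := exists_pair_eq hpq (by omega) x y
    have h1 : s • (g.1 *ᵥ (a • e p)) + t • (g.1 *ᵥ (b • e p + c • e q))
        = g.1 *ᵥ ((s * a + t * b) • e p + (t * c) • e q) := by
      rw [← mulVec_smul, ← mulVec_smul, ← mulVec_add]
      congr 1
      module
    have h2 : g.1 *ᵥ (a • e p) + g.1 *ᵥ (b • e p + c • e q)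
        = g.1 *ᵥ ((a + b) • e p + c • e q) := by
      rw [← mulVec_add]
      congr 1
      module
    have h3 : F (a • e p) = a ^ 2 • w := by
      have := hplane a 0
      simpa using this
    rw [h1, h2, hequiv, hequiv, hequiv, hequiv, hplane, hplane, hplane, h3]
    simp only [map_add, map_smul]
    module)
  refine ⟨B, fun g x y => ?_, ?_⟩
  · rw [hB, hB, ← mulVec_add, hequiv, hequiv, hequiv, map_sub, map_sub]
  · have h1 := hplane 1 0
    have h2 := hplane 2 0
    simp only [zero_smul, add_zero, one_smul, one_pow, mul_zero, zero_pow two_ne_zero] at h1 h2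
    rw [hB, ← two_smul ℝ (e p), h1, h2]
    module

lemma diag_ne_of_equivariant {p q : ι} (hpq : p ≠ q) {w : V} (hne : swapOp π p q w ≠ w)
    {B : (ι → ℝ) →ₗ[ℝ] (ι → ℝ) →ₗ[ℝ] V}
    (hB : ∀ (g : SO ι) x y, π g (B x y) = B (g.1 *ᵥ x) (g.1 *ᵥ y))
    (hBw : B (e p) (e p) = (2 : ℝ) • w) {i j : ι} (hij : i ≠ j) :
    B (e i) (e i) ≠ B (e j) (e j) := by
  intro h
  have h1 : B (e p) (e p) = B (e q) (e q) := by
    refine pair_transitive (P := fun i j => B (e i) (e i) = B (e j) (e j)) (fun _ _ => Eq.symm)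
      ?_ hij h hpq
    intro i j k hij hik hjk h
    have h2 := congrArg (swapOp π j k) h
    rwa [swapOp, hB, hB, half_pi_of_ne hij hik, half_pi_left hjk, one_smul, one_smul] at h2
  have h2 : swapOp π p q (B (e p) (e p)) = B (e q) (e q) := by
    rw [swapOp, hB, half_pi_left hpq, one_smul]
  rw [← h1, hBw, map_smul] at h2
  exact hne (smul_right_injective V two_ne_zero h2)

/-- The linear map on matrices induced by a bilinear map on vectors. -/
noncomputable def matMap (B : (ι → ℝ) →ₗ[ℝ] (ι → ℝ) →ₗ[ℝ] V) : Matrix ι ι ℝ →ₗ[ℝ] V where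
  toFun X := ∑ i, ∑ j, X i j • B (e i) (e j)
  map_add' X Y := by simp only [Matrix.add_apply, add_smul, Finset.sum_add_distrib]
  map_smul' c X := by
    simp only [Matrix.smul_apply, smul_eq_mul, mul_smul, Finset.smul_sum, RingHom.id_apply]

lemma mulVec_e (g : Matrix ι ι ℝ) (k : ι) : g *ᵥ e k = ∑ i, g i k • e i := by
  ext i
  simp [Finset.sum_apply, Pi.single_apply]

lemma matMap_conj {B : (ι → ℝ) →ₗ[ℝ] (ι → ℝ) →ₗ[ℝ] V}
    (hB : ∀ (g : SO ι) x y, π g (B x y) = B (g.1 *ᵥ x) (g.1 *ᵥ y)) (g : SO ι) (X : Matrix ι ι ℝ) :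
    matMap B (g.1 * X * g.1ᵀ) = π g (matMap B X) := by
  have h1 : ∀ k l, π g (B (e k) (e l)) = ∑ i, ∑ j, (g.1 i k * g.1 j l) • B (e i) (e j) := by
    intro k l
    rw [hB, mulVec_e, mulVec_e]
    simp only [map_sum, map_smul, LinearMap.sum_apply, LinearMap.smul_apply, smul_smul,
      Finset.smul_sum]
    rw [Finset.sum_comm]
    simp only [mul_comm]
  simp only [matMap, LinearMap.coe_mk, AddHom.coe_mk, map_sum, map_smul, h1, Matrix.mul_apply,
    Matrix.transpose_apply, Finset.sum_smul, Finset.sum_mul, Finset.smul_sum, smul_smul]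
  calc _ = ∑ i, ∑ j, ∑ k, ∑ l, (X k l * (g.1 i k * g.1 j l)) • B (e i) (e j) := by
        refine Finset.sum_congr rfl fun i _ => Finset.sum_congr rfl fun j _ => ?_
        rw [Finset.sum_comm]
        refine Finset.sum_congr rfl fun k _ => Finset.sum_congr rfl fun l _ => ?_
        congr 1
        ring
    _ = ∑ k, ∑ l, ∑ i, ∑ j, (X k l * (g.1 i k * g.1 j l)) • B (e i) (e j) := by
        rw [Finset.sum_congr rfl fun i _ => Finset.sum_comm, Finset.sum_comm]
        refine Finset.sum_congr rfl fun k _ => ?_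
        rw [Finset.sum_congr rfl fun i _ => Finset.sum_comm, Finset.sum_comm]

lemma matMap_diagonal (B : (ι → ℝ) →ₗ[ℝ] (ι → ℝ) →ₗ[ℝ] V) (μ : ι → ℝ) :
    matMap B (diagonal μ) = ∑ i, μ i • B (e i) (e i) := by
  simp only [matMap, LinearMap.coe_mk, AddHom.coe_mk]
  refine Finset.sum_congr rfl fun i _ => ?_
  rw [Finset.sum_eq_single i]
  · rw [diagonal_apply_eq]
  · intro j _ hj
    rw [diagonal_apply_ne _ hj.symm, zero_smul]
  · simp

lemma eq_of_matMap_diagonal_eq_zero {B : (ι → ℝ) →ₗ[ℝ] (ι → ℝ) →ₗ[ℝ] V}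
    (hB : ∀ (g : SO ι) x y, π g (B x y) = B (g.1 *ᵥ x) (g.1 *ᵥ y))
    (hdiag : ∀ i j, i ≠ j → B (e i) (e i) ≠ B (e j) (e j)) {μ : ι → ℝ}
    (h : matMap B (diagonal μ) = 0) (i j : ι) : μ i = μ j := by
  by_contra hμ
  have hij : i ≠ j := fun h => hμ (h ▸ rfl)
  rw [matMap_diagonal] at h
  have h1 : ∑ k, μ k • B (e (Equiv.swap i j k)) (e (Equiv.swap i j k)) = 0 := by
    have h2 := congrArg (swapOp π i j) h
    rw [map_zero, map_sum] at h2
    rw [← h2]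
    refine Finset.sum_congr rfl fun k _ => ?_
    rw [map_smul, swapOp, hB]
    by_cases hki : k = i
    · subst hki; rw [half_pi_left hij, one_smul, Equiv.swap_apply_left]
    by_cases hkj : k = j
    · subst hkj
      rw [half_pi_right hij, Equiv.swap_apply_right]
      simp only [map_smul, LinearMap.smul_apply, smul_smul]
      norm_num
    rw [half_pi_of_ne hki hkj, one_smul, Equiv.swap_apply_of_ne_of_ne hki hkj]
  have h3 : ∑ k, μ k • (B (e k) (e k) - B (e (Equiv.swap i j k)) (e (Equiv.swap i j k))) = 0 := by
    simp only [smul_sub, Finset.sum_sub_distrib, h, h1, sub_zero]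
  rw [Finset.sum_eq_add i j hij] at h3
  · rw [Equiv.swap_apply_left, Equiv.swap_apply_right] at h3
    have h4 : (μ i - μ j) • (B (e i) (e i) - B (e j) (e j)) = 0 := by
      linear_combination (norm := module) h3
    rcases smul_eq_zero.1 h4 with h5 | h5
    · exact hμ (sub_eq_zero.1 h5)
    · exact hdiag i j hij (sub_eq_zero.1 h5)
  · intro k _ hk
    rw [Equiv.swap_apply_of_ne_of_ne hk.1 hk.2, sub_self, smul_zero]
  · simp
  · simp

lemma exists_SO_diagonalization [Nonempty ι] {X : Matrix ι ι ℝ} (hX : Xᵀ = X) :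
    ∃ (g : SO ι) (μ : ι → ℝ), X = g.1 * diagonal μ * g.1ᵀ := by
  have hH : X.IsHermitian := by rw [IsHermitian, conjTranspose_eq_transpose_of_trivial, hX]
  obtain ⟨U, hU, μ, hUX⟩ : ∃ U : Matrix ι ι ℝ, Uᵀ * U = 1 ∧ ∃ μ : ι → ℝ,
      X = U * diagonal μ * Uᵀ := by
    refine ⟨hH.eigenvectorUnitary.1, ?_, hH.eigenvalues, ?_⟩
    · have h := (mem_unitaryGroup_iff' (A := hH.eigenvectorUnitary.1)).1 hH.eigenvectorUnitary.2
      rwa [star_eq_conjTranspose, conjTranspose_eq_transpose_of_trivial] at h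
    · have h := hH.spectral_theorem
      rw [Unitary.conjStarAlgAut_apply, star_eq_conjTranspose,
        conjTranspose_eq_transpose_of_trivial] at h
      exact h
  have hdet : U.det = 1 ∨ U.det = -1 := by
    have h := congrArg det hU
    rw [det_mul, det_transpose, det_one] at h
    exact mul_self_eq_one_iff.1 h
  rcases hdet with hdet | hdet
  · exact ⟨⟨U, mem_specialOrthogonalGroup_iff.2 ⟨(mem_orthogonalGroup_iff' _ _).2 hU, hdet⟩⟩, μ,
      hUX⟩
  obtain ⟨i⟩ := ‹Nonempty ι›
  set T : Matrix ι ι ℝ := diagonal (Function.update 1 i (-1)) with hT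
  have hTT : T * T = 1 := by
    rw [hT, diagonal_mul_diagonal, ← diagonal_one]
    congr 1
    ext j
    by_cases hj : j = i
    · subst hj; simp
    · simp [hj]
  have hTt : Tᵀ = T := diagonal_transpose _
  have hTdet : T.det = -1 := by
    rw [hT, det_diagonal, Finset.prod_update_of_mem (Finset.mem_univ i)]
    simp
  have hTμ : T * diagonal μ * T = diagonal μ := by
    have : T * diagonal μ = diagonal μ * T := by
      rw [hT, diagonal_mul_diagonal, diagonal_mul_diagonal]
      simp only [mul_comm]
    rw [this, mul_assoc, hTT, mul_one]
  refine ⟨⟨U * T, mem_specialOrthogonalGroup_iff.2 ⟨(mem_orthogonalGroup_iff' _ _).2 ?_, ?_⟩⟩, μ,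
    ?_⟩
  · change (U * T)ᵀ * (U * T) = 1
    rw [transpose_mul, hTt, mul_assoc, ← mul_assoc Uᵀ, hU, one_mul, hTT]
  · rw [det_mul, hdet, hTdet]; norm_num
  · change X = U * T * diagonal μ * (U * T)ᵀ
    rw [transpose_mul, hTt, hUX]
    conv_lhs => rw [← hTμ]
    simp only [mul_assoc]

lemma matMap_injOn [Nonempty ι] {B : (ι → ℝ) →ₗ[ℝ] (ι → ℝ) →ₗ[ℝ] V}
    (hB : ∀ (g : SO ι) x y, π g (B x y) = B (g.1 *ᵥ x) (g.1 *ᵥ y))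
    (hdiag : ∀ i j, i ≠ j → B (e i) (e i) ≠ B (e j) (e j)) {X : Matrix ι ι ℝ} (hX : Xᵀ = X)
    (htr : X.trace = 0) (h : matMap B X = 0) : X = 0 := by
  obtain ⟨g, μ, rfl⟩ := exists_SO_diagonalization hX
  rw [matMap_conj hB] at h
  have h1 := eq_of_matMap_diagonal_eq_zero hB hdiag
    (rep_injective π g (h.trans (map_zero _).symm))
  obtain ⟨i⟩ := ‹Nonempty ι›
  rw [mul_assoc, trace_mul_comm, mul_assoc, SO_transpose_mul, mul_one, trace_diagonal,
    Finset.sum_congr rfl fun j _ => h1 j i, Finset.sum_const, Finset.card_univ,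
    nsmul_eq_mul, mul_eq_zero] at htr
  have h2 : μ = 0 := by
    rcases htr with h3 | h3
    · exact absurd h3 (by have : Nonempty ι := ⟨i⟩; exact_mod_cast Fintype.card_ne_zero)
    · exact funext fun j => (h1 j i).trans h3
  rw [h2]
  simp

end Bilinear

section Embedding

variable {ι : Type*} [Fintype ι] [DecidableEq ι]
  {V : Type*} [NormedAddCommGroup V] [NormedSpace ℝ V] [FiniteDimensional ℝ V]
  {π : Representation ℝ (SO ι) V}

lemma diagonal_mulVec_e (δ : ι → ℝ) (i : ι) : diagonal δ *ᵥ e i = δ i • e i := by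
  ext j
  by_cases hj : j = i
  · subst hj; simp
  · simp [hj]

lemma half_pi_conj_diagonal {j k : ι} (hjk : j ≠ k) (δ : ι → ℝ) :
    (rot j k (Real.pi / 2)).1 * diagonal δ * (rot j k (Real.pi / 2)).1ᵀ
      = diagonal (δ ∘ Equiv.swap j k) := by
  have h : (rot j k (Real.pi / 2)).1 * diagonal δ
      = diagonal (δ ∘ Equiv.swap j k) * (rot j k (Real.pi / 2)).1 := by
    apply ext_of_mulVec_single
    intro i
    change _ *ᵥ e i = _ *ᵥ e i
    rw [← mulVec_mulVec, ← mulVec_mulVec, diagonal_mulVec_e, mulVec_smul]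
    by_cases hij : i = j
    · subst hij
      rw [half_pi_left hjk, mulVec_smul, diagonal_mulVec_e]
      simp
    by_cases hik : i = k
    · subst hik
      rw [half_pi_right hjk, mulVec_smul, diagonal_mulVec_e]
      simp
    rw [half_pi_of_ne hij hik, mulVec_smul, diagonal_mulVec_e, Function.comp_apply,
      Equiv.swap_apply_of_ne_of_ne hij hik, one_smul, one_smul]
  rw [h, mul_assoc, SO_mul_transpose, mul_one]

lemma IsSign.conj_diagonal {t : SO ι} {ε : ι → ℝ} (h : IsSign t ε) (δ : ι → ℝ) :
    t.1 * diagonal δ * t.1ᵀ = diagonal δ := by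
  have h1 := SO_mul_transpose t
  have h2 : t.1 * diagonal δ = diagonal δ * t.1 := by
    rw [h, diagonal_mul_diagonal, diagonal_mul_diagonal]
    simp only [mul_comm]
  rw [h2, mul_assoc, h1, mul_one]

/-- An equivariant embedding of the conjugation orbit of a non-scalar diagonal matrix into a small
representation yields an equivariant linear map which is injective on symmetric traceless
matrices. -/
theorem exists_equivariant_linear_injOn (hπ : ∀ v, Continuous fun g => π g v)
    (hcard : 5 ≤ Fintype.card ι) (hV : Module.finrank ℝ V < 2 * (Fintype.card ι).choose 2)
    {δ : ι → ℝ} {p q : ι} (hpq : δ p ≠ δ q) {E : Matrix ι ι ℝ → V}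
    (hinj : ∀ g h : SO ι, E (g.1 * diagonal δ * g.1ᵀ) = E (h.1 * diagonal δ * h.1ᵀ) →
      g.1 * diagonal δ * g.1ᵀ = h.1 * diagonal δ * h.1ᵀ)
    (hE : ∀ g : SO ι, E (g.1 * diagonal δ * g.1ᵀ) = π g (E (diagonal δ))) :
    ∃ Φ : Matrix ι ι ℝ →ₗ[ℝ] V, (∀ (g : SO ι) X, Φ (g.1 * X * g.1ᵀ) = π g (Φ X)) ∧
      ∀ X, Xᵀ = X → X.trace = 0 → Φ X = 0 → X = 0 := by
  have hpq' : p ≠ q := fun h => hpq (h ▸ rfl)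
  have hW : ∀ i j : ι, i ≠ j → Module.finrank ℝ (weightSpace π i j) ≤ 1 := fun i j hij =>
    finrank_weightSpace_le_one hcard hV hij
  set v := E (diagonal δ) with hv
  have hvm : v ∈ signFixed π := fun t ε h => by rw [hv, ← hE, h.conj_diagonal]
  have hswapE : ∀ j k, j ≠ k → swapOp π j k v = E (diagonal (δ ∘ Equiv.swap j k)) :=
    fun j k hjk => by rw [swapOp, hv, ← hE, half_pi_conj_diagonal hjk]
  have hne : swapOp π p q v ≠ v := by
    intro h
    have h1 := hinj (rot p q (Real.pi / 2)) 1 (by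
      rw [hE, hE, map_one, Module.End.one_apply]; exact h)
    rw [half_pi_conj_diagonal hpq', OneMemClass.coe_one, one_mul, transpose_one, mul_one] at h1
    have h2 := congrFun (diagonal_injective h1) p
    rw [Function.comp_apply, Equiv.swap_apply_left] at h2
    exact hpq h2.symm
  obtain ⟨w, hw, hst, hwne⟩ := exists_axial hπ hcard hW hpq' hvm hne (by
    intro j k l hjk hjl hkl h
    have h1 := hinj (rot j k (Real.pi / 2)) (rot j l (Real.pi / 2)) (by rw [hE, hE]; exact h)
    rw [half_pi_conj_diagonal hjk, half_pi_conj_diagonal hjl] at h1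
    have h2 := congrFun (diagonal_injective h1) k
    rw [Function.comp_apply, Function.comp_apply, Equiv.swap_apply_right,
      Equiv.swap_apply_of_ne_of_ne hjk.symm hkl] at h2
    rw [hswapE j k hjk, hv]
    congr 2
    ext i
    rw [Function.comp_apply]
    by_cases hij : i = j
    · subst hij; rw [Equiv.swap_apply_left, h2]
    by_cases hik : i = k
    · subst hik; rw [Equiv.swap_apply_right, h2]
    rw [Equiv.swap_apply_of_ne_of_ne hij hik])
  obtain ⟨B, hB, hBw⟩ := exists_equivariant_bilinear hπ hcard hpq' (hW p q hpq') hw hst hwne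
  have : Nonempty ι := ⟨p⟩
  exact ⟨matMap B, matMap_conj hB, fun X hX htr h =>
    matMap_injOn hB (fun i j hij => diag_ne_of_equivariant hpq' hwne hB hBw hij) hX htr h⟩

end Embedding

lemma le_finrank_symTraceless (n : ℕ) (hn : 1 ≤ n) :
    (n - 1) * (n + 2) ≤ 2 * Module.finrank ℝ (symTraceless n) := by
  let T : Matrix (Fin n) (Fin n) ℝ →ₗ[ℝ] ((Σ j : Fin n, Fin j.1) → ℝ) × ℝ :=
    { toFun := fun X => (fun s => X (s.2.castLE s.1.2.le) s.1 - X s.1 (s.2.castLE s.1.2.le),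
        X.trace)
      map_add' := fun X Y => by
        refine Prod.ext (funext fun s => ?_) (trace_add X Y)
        simp only [Matrix.add_apply, Prod.mk_add_mk, Pi.add_apply]
        ring
      map_smul' := fun c X => by
        refine Prod.ext (funext fun s => ?_) (trace_smul c X)
        simp only [Matrix.smul_apply, smul_eq_mul, RingHom.id_apply, Prod.smul_mk, Pi.smul_apply]
        ring }
  have hker : LinearMap.ker T ≤ symTraceless n := by
    intro X hX
    have hX1 := congrArg Prod.fst (LinearMap.mem_ker.1 hX)
    have hX2 : X.trace = 0 := congrArg Prod.snd (LinearMap.mem_ker.1 hX)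
    have hlt : ∀ i j : Fin n, i < j → X i j = X j i := fun i j hij =>
      sub_eq_zero.1 (congrFun hX1 ⟨j, ⟨i.1, hij⟩⟩)
    refine ⟨?_, hX2⟩
    ext i j
    rw [transpose_apply]
    rcases lt_trichotomy i j with h | h | h
    · exact (hlt i j h).symm
    · rw [h]
    · exact hlt j i h
  have h1 := LinearMap.finrank_range_add_finrank_ker T
  have h2 := Submodule.finrank_mono hker
  have h3 := Submodule.finrank_le (LinearMap.range T)
  have h4 : (∑ j : Fin n, j.1) * 2 = n * (n - 1) := by
    rw [Fin.sum_univ_eq_sum_range (fun i => i) n, Finset.sum_range_id_mul_two]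
  rw [Module.finrank_prod, Module.finrank_fintype_fun_eq_card, Module.finrank_self,
    Fintype.card_sigma] at h3
  simp only [Fintype.card_fin] at h3
  rw [Module.finrank_matrix, Fintype.card_fin, Module.finrank_self, mul_one] at h1
  obtain ⟨m, rfl⟩ : ∃ m, n = m + 1 := ⟨n - 1, by omega⟩
  rw [Nat.add_sub_cancel] at h4 ⊢
  nlinarith

end FlagEmbedding

/-- With `M = {Q D Qᵀ : Q ∈ SO_n(ℝ)}` the isospectral model of the flag
manifold (`n ≥ 17`, `p ≥ 1`), if `(V, ρ)` is a finite-dimensional continuous real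
representation of `SO_n(ℝ)` (realized on `V = ℝᵈ`) with `dim V = (n−1)(n+2)/2`, i.e.
`2d = (n−1)(n+2)`, and there exists an injective continuous `SO_n(ℝ)`-equivariant map
`ε : M → V`, then `V` is isomorphic as an `SO_n(ℝ)`-representation to `Sym²₀(ℝⁿ)` with the
conjugation action: there is a linear bijection `V → Sym²₀(ℝⁿ)` intertwining the actions. -/
theorem iso_symTraceless_of_minimal_equivariant_embedding_of_flag
    (n p : ℕ) (hn : 17 ≤ n) (hp : 1 ≤ p)
    (nn : Fin (p + 1) → ℕ) (hpos : ∀ i, 0 < nn i) (hsum : ∑ i, nn i = n)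
    (blk : Fin n → Fin (p + 1)) (hmono : Monotone blk)
    (hfib : ∀ i, (Finset.univ.filter fun j => blk j = i).card = nn i)
    (a : Fin (p + 1) → ℝ) (ha : Function.Injective a)
    (D : Matrix (Fin n) (Fin n) ℝ) (hD : D = Matrix.diagonal fun j => a (blk j))
    (M : Set (Matrix (Fin n) (Fin n) ℝ)) (hM : M = {X | ∃ Q ∈ SOn n, X = Q * D * Qᵀ})
    (d : ℕ) (hd : 2 * d = (n - 1) * (n + 2))
    (ρ : Matrix (Fin n) (Fin n) ℝ → Matrix (Fin d) (Fin d) ℝ)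
    (hρ1 : ρ 1 = 1)
    (hρmul : ∀ Q ∈ SOn n, ∀ R ∈ SOn n, ρ (Q * R) = ρ Q * ρ R)
    (hρunit : ∀ Q ∈ SOn n, IsUnit (ρ Q))
    (hρcont : ContinuousOn ρ (SOn n))
    (hε : ∃ ε : Matrix (Fin n) (Fin n) ℝ → Fin d → ℝ,
      Set.InjOn ε M ∧ ContinuousOn ε M ∧
        ∀ Q ∈ SOn n, ∀ X ∈ M, ε (Q * X * Qᵀ) = (ρ Q).mulVec (ε X)) :
    ∃ e : (Fin d → ℝ) ≃ₗ[ℝ] symTraceless n,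
      ∀ Q ∈ SOn n, ∀ v : Fin d → ℝ,
        (e ((ρ Q).mulVec v) : Matrix (Fin n) (Fin n) ℝ)
          = Q * (e v : Matrix (Fin n) (Fin n) ℝ) * Qᵀ := by
  open FlagEmbedding in
  obtain ⟨ε, hεinj, -, hεeq⟩ := hε
  have hmem : ∀ g : SO (Fin n), g.1 ∈ SOn n := fun g =>
    ⟨SO_transpose_mul g, (mem_specialOrthogonalGroup_iff.1 g.2).2⟩
  let π : Representation ℝ (SO (Fin n)) (Fin d → ℝ) :=
    { toFun := fun g => (ρ g.1).mulVecLin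
      map_one' := by rw [OneMemClass.coe_one, hρ1, mulVecLin_one]; rfl
      map_mul' := fun g h => by
        rw [Submonoid.coe_mul, hρmul _ (hmem g) _ (hmem h), mulVecLin_mul]; rfl }
  have hπ : ∀ v, Continuous fun g => π g v := fun v => by
    have h1 : Continuous fun g : SO (Fin n) => ρ g.1 :=
      hρcont.comp_continuous continuous_subtype_val hmem
    exact h1.matrix_mulVec continuous_const
  have hDM : ∀ g : SO (Fin n), g.1 * D * g.1ᵀ ∈ M := fun g => hM ▸ ⟨g.1, hmem g, rfl⟩
  have hDM1 : D ∈ M := by simpa using hDM 1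
  have hblk : ∀ i, ∃ j, blk j = i := fun i => by
    have h := hpos i
    rw [← hfib i, Finset.card_pos] at h
    obtain ⟨j, hj⟩ := h
    exact ⟨j, (Finset.mem_filter.1 hj).2⟩
  obtain ⟨i, hi⟩ := hblk 0
  obtain ⟨j, hj⟩ := hblk (Fin.last p)
  have hij : a (blk i) ≠ a (blk j) := fun h => by
    have h1 := ha h
    rw [hi, hj] at h1
    have h2 := congrArg Fin.val h1
    rw [Fin.val_zero, Fin.val_last] at h2
    omega
  obtain ⟨m, rfl⟩ : ∃ m, n = m + 1 := ⟨n - 1, by omega⟩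
  subst hD
  obtain ⟨Φ, hΦ, hΦinj⟩ := exists_equivariant_linear_injOn (π := π) hπ
    (by rw [Fintype.card_fin]; omega)
    (by
      rw [Module.finrank_fintype_fun_eq_card, Fintype.card_fin, Fintype.card_fin]
      rw [Nat.choose_two_right, Nat.add_sub_cancel]
      have h2 : 2 * ((m + 1) * m / 2) = (m + 1) * m :=
        Nat.mul_div_cancel' (by rw [mul_comm]; exact (Nat.even_mul_succ_self m).two_dvd)
      rw [Nat.add_sub_cancel] at hd
      rw [h2]
      nlinarith)
    (δ := fun j => a (blk j)) hij (E := ε)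
    (fun g h heq => hεinj (hDM g) (hDM h) heq)
    (fun g => hεeq g.1 (hmem g) _ hDM1)
  let Ψ : symTraceless (m + 1) →ₗ[ℝ] (Fin d → ℝ) := Φ.domRestrict _
  have hΨ : Function.Injective Ψ := by
    rw [← LinearMap.ker_eq_bot, LinearMap.ker_eq_bot']
    intro X hX
    exact Subtype.ext (hΦinj X.1 X.2.1 X.2.2 hX)
  have hfin : Module.finrank ℝ (symTraceless (m + 1)) = Module.finrank ℝ (Fin d → ℝ) := by
    refine le_antisymm (LinearMap.finrank_le_finrank_of_injective hΨ) ?_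
    have h := le_finrank_symTraceless (m + 1) (by omega)
    rw [Module.finrank_fintype_fun_eq_card, Fintype.card_fin]
    omega
  let f := LinearMap.linearEquivOfInjective Ψ hΨ hfin
  refine ⟨f.symm, fun Q hQ v => ?_⟩
  obtain ⟨X, rfl⟩ := f.surjective v
  let g : SO (Fin (m + 1)) :=
    ⟨Q, mem_specialOrthogonalGroup_iff.2 ⟨(mem_orthogonalGroup_iff' _ _).2 hQ.1, hQ.2⟩⟩
  have hQX : Q * X.1 * Qᵀ ∈ symTraceless (m + 1) := by
    refine ⟨?_, ?_⟩
    · rw [transpose_mul, transpose_mul, transpose_transpose, X.2.1, mul_assoc]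
    · rw [mul_assoc, trace_mul_comm, mul_assoc, hQ.1, mul_one]
      exact X.2.2
  have h1 : (ρ Q).mulVec (f X) = f ⟨Q * X.1 * Qᵀ, hQX⟩ := (hΦ g X.1).symm
  rw [h1, f.symm_apply_apply, f.symm_apply_apply]
end
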